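/- arXiv:1804.06983 — 2 statements merged into one kernel-verified Lean document; each statement's English description precedes it below -/
import Mathlib

section
/- Let X be an Asplund space, φ : X → ℝ ∪ {+∞} a proper lower semicontinuous function, and α > 0. Suppose that for all x, y ∈ X with φ(y) ≤ φ(x) and all x* ∈ ∂̂φ(x) one has ⟨x*, y − x⟩ ≤ −min{α‖y − x‖, φ(x) − φ(y)}. Then φ is α-robustly quasiconvex. -/
open Filter Topology

/-- `X` is an Asplund space: every closed separable subspace has separable dual. -/
def IsAsplund (X : Type*) [NormedAddCommGroup X] [NormedSpace ℝ X] : Prop :=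
  ∀ Y : Submodule ℝ X, IsClosed (Y : Set X) →
    TopologicalSpace.SeparableSpace Y →
    TopologicalSpace.SeparableSpace (StrongDual ℝ Y)

/-- Quasiconvexity of an extended-real-valued function. -/
def QuasiconvexFn {X : Type*} [AddCommGroup X] [Module ℝ X] (φ : X → EReal) : Prop :=
  ∀ x y : X, ∀ l : ℝ, 0 < l → l < 1 → φ (l • x + (1 - l) • y) ≤ max (φ x) (φ y)

/-- The Fréchet subdifferential of `φ` at `x`. -/
def FrechetSubdiff {X : Type*} [NormedAddCommGroup X] [NormedSpace ℝ X]
    (φ : X → EReal) (x : X) : Set (X →L[ℝ] ℝ) :=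
  {xs | φ x ≠ ⊤ ∧ ∀ ε : ℝ, 0 < ε →
    ∀ᶠ y in 𝓝 x, φ x + ↑(xs (y - x)) - ↑(ε * ‖y - x‖) ≤ φ y}

/-- `φ` is `α`-robustly quasiconvex. -/
def RobustlyQuasiconvex {X : Type*} [NormedAddCommGroup X] [NormedSpace ℝ X]
    (φ : X → EReal) (α : ℝ) : Prop :=
  ∀ vs : X →L[ℝ] ℝ, ‖vs‖ ≤ α → QuasiconvexFn (fun z => φ z + ↑(vs z))

/-- A smooth approximation of the norm exists at every scale. -/
def SmoothGauge (Y : Type*) [NormedAddCommGroup Y] [NormedSpace ℝ Y] : Prop :=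
  ∀ ε : ℝ, 0 < ε → ∃ (s : Y → ℝ) (s' : Y → (Y →L[ℝ] ℝ)),
    (∀ x, HasFDerivAt s (s' x) x) ∧ (∀ x, ‖s' x‖ ≤ 1) ∧ (∀ x, 0 ≤ s x) ∧ s 0 = 0 ∧
    (∀ x, ‖x‖ - ε ≤ s x) ∧ (∀ x y, s x + s' x (y - x) ≤ s y)

section gauge
variable {Y : Type*} [NormedAddCommGroup Y] [NormedSpace ℝ Y]

/-- weighted sum of squared distances -/
noncomputable def psiFn (y : ℕ → (Y →L[ℝ] ℝ)) (w : Y →L[ℝ] ℝ) : ℝ :=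
  ∑' k, (1/2 : ℝ)^k * ‖w - y k‖^2

lemma psi_term_bound (y : ℕ → (Y →L[ℝ] ℝ)) (hy : ∀ k, ‖y k‖ ≤ 1) (w : Y →L[ℝ] ℝ)
    (hw : ‖w‖ ≤ 1) (k : ℕ) : (1/2 : ℝ)^k * ‖w - y k‖^2 ≤ (1/2 : ℝ)^k * 4 := by
  have h1 : ‖w - y k‖ ≤ 2 := (norm_sub_le _ _).trans (by linarith [hy k])
  have h2 : ‖w - y k‖^2 ≤ 4 := by nlinarith [norm_nonneg (w - y k)]
  gcongr

lemma psi_summable (y : ℕ → (Y →L[ℝ] ℝ)) (hy : ∀ k, ‖y k‖ ≤ 1) (w : Y →L[ℝ] ℝ)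
    (hw : ‖w‖ ≤ 1) : Summable (fun k => (1/2 : ℝ)^k * ‖w - y k‖^2) :=
  Summable.of_nonneg_of_le (fun k => by positivity) (psi_term_bound y hy w hw)
    (summable_geometric_two.mul_right 4)

lemma psi_nonneg (y : ℕ → (Y →L[ℝ] ℝ)) (w : Y →L[ℝ] ℝ) : 0 ≤ psiFn y w :=
  tsum_nonneg (fun k => by positivity)

lemma psi_le (y : ℕ → (Y →L[ℝ] ℝ)) (hy : ∀ k, ‖y k‖ ≤ 1) (w : Y →L[ℝ] ℝ)
    (hw : ‖w‖ ≤ 1) : psiFn y w ≤ 8 := by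
  have := (psi_summable y hy w hw).tsum_le_tsum (psi_term_bound y hy w hw)
    (summable_geometric_two.mul_right 4)
  rw [tsum_mul_right, tsum_geometric_two] at this
  unfold psiFn; linarith

lemma psi_mid (y : ℕ → (Y →L[ℝ] ℝ)) (hy : ∀ k, ‖y k‖ ≤ 1) (v w : Y →L[ℝ] ℝ)
    (hv : ‖v‖ ≤ 1) (hw : ‖w‖ ≤ 1) (k : ℕ) :
    (1/2 : ℝ)^k * ((‖v - y k‖ - ‖w - y k‖)^2 / 4) ≤
      (psiFn y v + psiFn y w)/2 - psiFn y ((1/2 : ℝ) • (v + w)) := by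
  have hm : ‖(1/2 : ℝ) • (v + w)‖ ≤ 1 := by
    rw [norm_smul]; have := norm_add_le v w; norm_num; linarith
  have hs := (((psi_summable y hy v hv).add (psi_summable y hy w hw)).div_const 2).sub
    (psi_summable y hy _ hm)
  have hterm : ∀ k, (1/2 : ℝ)^k * ((‖v - y k‖ - ‖w - y k‖)^2 / 4) ≤
     ((1/2 : ℝ)^k * ‖v - y k‖^2 + (1/2 : ℝ)^k * ‖w - y k‖^2)/2 -
      (1/2 : ℝ)^k * ‖(1/2 : ℝ) • (v + w) - y k‖^2 := by
    intro k
    have h1 : (1/2 : ℝ) • (v + w) - y k = (1/2 : ℝ) • ((v - y k) + (w - y k)) := by module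
    have h2 : ‖(1/2 : ℝ) • (v + w) - y k‖ ≤ (‖v - y k‖ + ‖w - y k‖)/2 := by
      rw [h1, norm_smul]; have := norm_add_le (v - y k) (w - y k); norm_num; linarith
    have h3 : ‖(1/2 : ℝ) • (v + w) - y k‖^2 ≤ ((‖v - y k‖ + ‖w - y k‖)/2)^2 := by
      gcongr
    have h4 : (0:ℝ) ≤ (1/2 : ℝ)^k := by positivity
    nlinarith [mul_le_mul_of_nonneg_left h3 h4]
  have h5 := hs.le_tsum k (fun j _ => le_trans (by positivity) (hterm j))
  have h6 : (psiFn y v + psiFn y w)/2 - psiFn y ((1/2 : ℝ) • (v + w)) =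
    ∑' k, (((1/2 : ℝ)^k * ‖v - y k‖^2 + (1/2 : ℝ)^k * ‖w - y k‖^2)/2 -
      (1/2 : ℝ)^k * ‖(1/2 : ℝ) • (v + w) - y k‖^2) := by
    rw [Summable.tsum_sub (((psi_summable y hy v hv).add (psi_summable y hy w hw)).div_const 2)
      (psi_summable y hy _ hm), tsum_div_const,
      Summable.tsum_add (psi_summable y hy v hv) (psi_summable y hy w hw)]
    rfl
  rw [h6]
  exact (hterm k).trans h5

lemma psi_max (y : ℕ → (Y →L[ℝ] ℝ)) (hy : ∀ k, ‖y k‖ ≤ 1) (e : ℝ) (he : 0 < e) (x : Y) :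
    ∃ w : Y →L[ℝ] ℝ, ‖w‖ ≤ 1 ∧ ∀ v : Y →L[ℝ] ℝ, ‖v‖ ≤ 1 →
      v x - e * psiFn y v ≤ w x - e * psiFn y w := by
  let K : Set (WeakDual ℝ Y) := WeakDual.toStrongDual ⁻¹' Metric.closedBall 0 1
  have hK : IsCompact K := WeakDual.isCompact_closedBall 0 1
  have : CompactSpace K := isCompact_iff_compactSpace.mp hK
  let F : K → ℝ := fun w => psiFn y (WeakDual.toStrongDual w.1)
  have hKn : ∀ w : K, ‖WeakDual.toStrongDual w.1‖ ≤ 1 := fun w => by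
    exact mem_closedBall_zero_iff.mp w.2
  have hlsc1 : ∀ k, LowerSemicontinuous
      (fun w : K => (1/2 : ℝ)^k * ‖WeakDual.toStrongDual w.1 - y k‖^2) := by
    intro k
    rw [lowerSemicontinuous_iff_isClosed_preimage]
    intro c
    have : (fun w : K => (1/2 : ℝ)^k * ‖WeakDual.toStrongDual w.1 - y k‖^2) ⁻¹' Set.Iic c =
        if 0 ≤ c then (Subtype.val ⁻¹' (WeakDual.toStrongDual ⁻¹'
          Metric.closedBall (y k) (Real.sqrt (2^k * c)))) else ∅ := by
      split_ifs with hc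
      · ext w
        simp only [Set.mem_preimage, Set.mem_Iic, Metric.mem_closedBall, dist_eq_norm]
        rw [Real.le_sqrt (norm_nonneg _) (by positivity), one_div, inv_pow,
          inv_mul_le_iff₀ (by positivity)]
      · ext w
        simp only [Set.mem_preimage, Set.mem_Iic, Set.mem_empty_iff_false, iff_false, not_le]
        exact lt_of_lt_of_le (not_le.mp hc) (by positivity)
    rw [this]
    split_ifs
    · exact (WeakDual.isClosed_closedBall _ _).preimage continuous_subtype_val
    · exact isClosed_empty
  have hlsc : LowerSemicontinuous (fun w : K => e * F w) := by
    rw [lowerSemicontinuous_iff_isClosed_preimage]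
    intro c
    have : (fun w : K => e * F w) ⁻¹' Set.Iic c =
        ⋂ n : ℕ, (fun w : K => ∑ k ∈ Finset.range n,
          (1/2 : ℝ)^k * ‖WeakDual.toStrongDual w.1 - y k‖^2) ⁻¹' Set.Iic (c / e) := by
      ext w
      simp only [Set.mem_preimage, Set.mem_Iic, Set.mem_iInter]
      rw [mul_comm, ← le_div_iff₀ he]
      constructor
      · intro h n
        exact ((psi_summable y hy _ (hKn w)).sum_le_tsum _
          (fun k _ => by positivity)).trans h
      · intro h
        exact (psi_summable y hy _ (hKn w)).tsum_le_of_sum_range_le h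
    rw [this]
    refine isClosed_iInter fun n => ?_
    exact (lowerSemicontinuous_iff_isClosed_preimage.mp
      (lowerSemicontinuous_sum (fun i _ => hlsc1 i))) _
  have hcont : Continuous (fun w : K => - (w.1 x)) :=
    ((WeakDual.eval_continuous x).comp continuous_subtype_val).neg
  have h := hlsc.add hcont.lowerSemicontinuous
  obtain ⟨w, -, hw⟩ := (h.lowerSemicontinuousOn Set.univ).exists_isMinOn
    ⟨⟨0, by simp [K]⟩, Set.mem_univ _⟩ isCompact_univ
  refine ⟨WeakDual.toStrongDual w.1, hKn w, fun v hv => ?_⟩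
  have h2 := hw (Set.mem_univ (⟨WeakDual.toStrongDual.symm v, by simpa [K] using hv⟩ : K))
  simp only [F, Set.mem_ofPred_eq] at h2
  have h3 : (WeakDual.toStrongDual w.1) x = w.1 x := rfl
  have h4 : (WeakDual.toStrongDual.symm v : WeakDual ℝ Y) x = v x := rfl
  rw [LinearEquiv.apply_symm_apply, h4] at h2
  rw [h3]
  linarith

lemma smoothGauge_pre (hsep : TopologicalSpace.SeparableSpace (StrongDual ℝ Y))
    (ε : ℝ) (hε : 0 < ε) : ∃ (s : Y → ℝ) (s' : Y → (Y →L[ℝ] ℝ)),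
    (∀ x, HasFDerivAt s (s' x) x) ∧ (∀ x, ‖s' x‖ ≤ 1) ∧ (∀ x, s x ≤ ‖x‖) ∧
    (∀ x, ‖x‖ - ε ≤ s x) ∧ (∀ x y, s x + s' x (y - x) ≤ s y) := by
  have := hsep
  have : SecondCountableTopology (StrongDual ℝ Y) :=
    UniformSpace.secondCountable_of_separable _
  let B : Set (StrongDual ℝ Y) := Metric.closedBall 0 1
  have : Nonempty B := ⟨⟨0, by simp [B]⟩⟩
  let y : ℕ → StrongDual ℝ Y := fun k => (TopologicalSpace.denseSeq B k).1
  have hy : ∀ k, ‖y k‖ ≤ 1 := fun k => by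
    exact mem_closedBall_zero_iff.mp (TopologicalSpace.denseSeq B k).2
  have hdense : ∀ w : StrongDual ℝ Y, ‖w‖ ≤ 1 → ∀ r > 0, ∃ k, ‖w - y k‖ < r := by
    intro w hw r hr
    have := (TopologicalSpace.denseRange_denseSeq B).exists_dist_lt
      (⟨w, by simpa [B] using hw⟩ : B) hr
    obtain ⟨k, hk⟩ := this
    exact ⟨k, by rw [Subtype.dist_eq, dist_eq_norm] at hk; exact hk⟩
  set e := ε / 8 with he
  have he0 : 0 < e := by positivity
  choose w hw hmax using psi_max y hy e he0
  have hsub : ∀ x z, (w x x - e * psiFn y (w x)) + w x (z - x) ≤ w z z - e * psiFn y (w z) := by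
    intro x z
    have := hmax z (w x) (hw x)
    rw [map_sub]; linarith
  have hap : ∀ (u : Y →L[ℝ] ℝ), ‖u‖ ≤ 1 → ∀ x, u x ≤ ‖x‖ := by
    intro u hu x
    have := (le_abs_self _).trans (u.le_opNorm x)
    nlinarith [norm_nonneg x]
  refine ⟨fun x => w x x - e * psiFn y (w x), w, ?_, hw, ?_, ?_, hsub⟩
  · intro x
    rw [hasFDerivAt_iff_isLittleO_nhds_zero, Asymptotics.isLittleO_iff]
    intro c hc
    obtain ⟨k, hk⟩ := hdense (w x) (hw x) (c/4) (by positivity)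
    have hr : 0 < e * (1/2 : ℝ)^k * (c/4)^2 / 4 := by positivity
    filter_upwards [Metric.ball_mem_nhds (0:Y) hr] with h hh
    rw [mem_ball_zero_iff] at hh
    have h1 := hsub x (x + h)
    have h2 := hsub (x + h) x
    rw [add_sub_cancel_left] at h1
    rw [sub_add_cancel_left, map_neg] at h2
    have hmid := hmax x ((1/2 : ℝ) • (w x + w (x+h))) (by
      rw [norm_smul]; have := norm_add_le (w x) (w (x+h))
      have := hw x; have := hw (x+h); norm_num; linarith)
    have h3 := psi_mid y hy (w x) (w (x+h)) (hw x) (hw (x+h)) k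
    have h4 := hap _ (hw (x+h)) h
    have h5 := hap _ (hw x) (-h)
    rw [norm_neg, map_neg] at h5
    simp only [_root_.smul_apply, _root_.add_apply, smul_eq_mul]
      at hmid
    rw [map_add] at h1 h2
    have h6 : e * ((1/2 : ℝ)^k * ((‖w x - y k‖ - ‖w (x+h) - y k‖)^2 / 4)) ≤ ‖h‖ := by
      have := mul_le_mul_of_nonneg_left h3 he0.le
      linarith
    have h7 : (‖w x - y k‖ - ‖w (x+h) - y k‖)^2 < (c/4)^2 := by
      have h8 : (e * (1/2 : ℝ)^k / 4) * (‖w x - y k‖ - ‖w (x+h) - y k‖)^2 <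
        (e * (1/2 : ℝ)^k / 4) * (c/4)^2 := by
        calc _ = e * ((1/2 : ℝ)^k * ((‖w x - y k‖ - ‖w (x+h) - y k‖)^2 / 4)) := by ring
          _ ≤ ‖h‖ := h6
          _ < _ := hh
          _ = _ := by ring
      exact lt_of_mul_lt_mul_left h8 (by positivity)
    have h9 := abs_lt_of_sq_lt_sq h7 (by positivity)
    have h10 : ‖w (x+h) - w x‖ ≤ c := by
      have : w (x+h) - w x = (w (x+h) - y k) - (w x - y k) := by abel
      rw [this]
      refine (norm_sub_le _ _).trans ?_
      have := (abs_lt.mp h9).1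
      linarith
    have h11 : w (x+h) h - w x h ≤ c * ‖h‖ := by
      have := (le_abs_self _).trans ((w (x+h) - w x).le_opNorm h)
      rw [_root_.sub_apply] at this
      refine this.trans ?_
      gcongr
    rw [Real.norm_eq_abs, abs_le]
    rw [map_add]
    constructor
    · have : 0 ≤ c * ‖h‖ := by positivity
      linarith
    · linarith
  · intro x
    have := hap _ (hw x) x
    have := mul_nonneg he0.le (psi_nonneg y (w x))
    linarith
  · intro x
    obtain ⟨u, hu, hux⟩ := exists_dual_vector'' ℝ x
    have h1 := hmax x u hu
    have h2 := mul_le_mul_of_nonneg_left (psi_le y hy u hu) he0.le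
    have h3 : u x = ‖x‖ := by simpa using hux
    have h4 : e * 8 = ε := by rw [he]; ring
    linarith

lemma smoothGauge_of_separable (hsep : TopologicalSpace.SeparableSpace (StrongDual ℝ Y)) :
    SmoothGauge Y := by
  intro ε hε
  obtain ⟨s, s', hd, hn, hle, hge, hsub⟩ := smoothGauge_pre hsep ε hε
  refine ⟨fun x => (1/2 : ℝ) * (s x + s (-x)) - s 0,
    fun x => (1/2 : ℝ) • (s' x - s' (-x)), ?_, ?_, ?_, ?_, ?_, ?_⟩
  · intro x
    have h1 : HasFDerivAt (fun x => s (-x)) ((s' (-x)).comp (-(ContinuousLinearMap.id ℝ Y))) x :=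
      (hd (-x)).comp x (hasFDerivAt_id x).neg
    have h2 := (((hd x).add h1).const_mul (1/2 : ℝ)).sub_const (s 0)
    have h3 : (1/2 : ℝ) • (s' x + (s' (-x)).comp (-(ContinuousLinearMap.id ℝ Y))) =
        (1/2 : ℝ) • (s' x - s' (-x)) := by
      ext v
      simp [sub_eq_add_neg]
    rw [h3] at h2
    exact h2
  · intro x
    rw [norm_smul]
    have := norm_sub_le (s' x) (s' (-x))
    have := hn x; have := hn (-x)
    norm_num; linarith
  · intro x
    have h1 := hsub 0 x
    have h2 := hsub 0 (-x)
    simp only [sub_zero, map_neg] at h1 h2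
    linarith
  · simp; ring
  · intro x
    have h1 := hge x; have h2 := hge (-x); have h3 := hle 0
    rw [norm_neg] at h2; rw [norm_zero] at h3
    linarith
  · intro x y
    have h1 := hsub x y
    have h2 := hsub (-x) (-y)
    have : -y - -x = -(y - x) := by abel
    rw [this, map_neg] at h2
    simp only [_root_.smul_apply, _root_.sub_apply, smul_eq_mul]
    linarith
end gauge

section svp
variable {Y : Type*} [NormedAddCommGroup Y] [NormedSpace ℝ Y]

lemma closed_add_cont (D : Set Y) (g : Y → ℝ) (hcl : ∀ L : ℝ, IsClosed {x | x ∈ D ∧ g x ≤ L})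
    (P : Y → ℝ) (hP : Continuous P) (u : ℕ → Y) (x : Y) (hu : Tendsto u atTop (𝓝 x)) (L : ℝ)
    (h : ∀ᶠ j in atTop, u j ∈ D ∧ g (u j) + P (u j) ≤ L) : x ∈ D ∧ g x + P x ≤ L := by
  have key : ∀ e > 0, x ∈ D ∧ g x ≤ L - P x + e := by
    intro e he
    have h1 : ∀ᶠ j in atTop, P x - e < P (u j) :=
      ((hP.tendsto x).comp hu).eventually (lt_mem_nhds (by linarith))
    refine (hcl (L - P x + e)).mem_of_tendsto hu ?_
    filter_upwards [h, h1] with j hj hj1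
    exact ⟨hj.1, by linarith [hj.2]⟩
  refine ⟨(key 1 one_pos).1, ?_⟩
  have : g x ≤ L - P x := le_of_forall_pos_le_add (fun e he => (key e he).2)
  linarith

theorem svp [CompleteSpace Y] (hS : SmoothGauge Y) (D : Set Y) (g : Y → ℝ) (m : ℝ)
    (hm : ∀ x ∈ D, m ≤ g x) (hcl : ∀ L : ℝ, IsClosed {x | x ∈ D ∧ g x ≤ L})
    (x0 : Y) (hx0 : x0 ∈ D) (δ η : ℝ) (hδ : 0 < δ) (hη : 0 < η) :
    ∃ (x : Y) (G : Y → ℝ) (G' : Y →L[ℝ] ℝ), x ∈ D ∧ HasFDerivAt G G' x ∧ ‖G'‖ ≤ δ ∧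
      (∀ y ∈ D, g x + G x ≤ g y + G y) ∧ g x ≤ g x0 + η := by
  have hS' : ∀ k : ℕ, ∃ (s : Y → ℝ) (s' : Y → (Y →L[ℝ] ℝ)),
    (∀ x, HasFDerivAt s (s' x) x) ∧ (∀ x, ‖s' x‖ ≤ 1) ∧ (∀ x, 0 ≤ s x) ∧ s 0 = 0 ∧
    (∀ x, ‖x‖ - (1/2 : ℝ)^k ≤ s x) ∧ (∀ x y, s x + s' x (y - x) ≤ s y) :=
    fun k => hS _ (by positivity)
  choose s s' hd hn hpos hzero hge hsub using hS'
  have hsel : ∀ (P : Y → ℝ) (e : ℝ), ∃ x, (∀ y, 0 ≤ P y) → 0 < e →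
      x ∈ D ∧ ∀ y ∈ D, g x + P x ≤ g y + P y + e := by
    intro P e
    by_cases hP : (∀ y, 0 ≤ P y) ∧ 0 < e
    swap
    · exact ⟨0, fun h1 h2 => absurd ⟨h1, h2⟩ hP⟩
    obtain ⟨hP, he⟩ := hP
    let I := (fun y => g y + P y) '' D
    have hne : I.Nonempty := ⟨_, x0, hx0, rfl⟩
    have hbd : BddBelow I := ⟨m, by
      rintro _ ⟨y, hy, rfl⟩
      have := hm y hy; have := hP y
      show m ≤ g y + P y
      linarith⟩
    obtain ⟨_, ⟨x, hx, rfl⟩, hlt⟩ := Real.lt_sInf_add_pos hne he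
    refine ⟨x, fun _ _ => ⟨hx, fun y hy => ?_⟩⟩
    have := csInf_le hbd ⟨y, hy, rfl⟩
    simp only at this hlt
    linarith
  choose sel hsel using hsel
  let μ : ℕ → ℝ := fun k => δ / 2 * (1/2)^k
  let et : ℕ → ℝ := fun k => η / 4 * (1/4)^k
  have hμ : ∀ k, 0 < μ k := fun k => by positivity
  have het : ∀ k, 0 < et k := fun k => by positivity
  let nxt : ℕ → Y × (Y → ℝ) → (Y → ℝ) := fun k q => fun y => q.2 y + μ k * s k (y - q.1)
  let st : ℕ → Y × (Y → ℝ) := fun n => Nat.rec (sel 0 (et 0), 0)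
    (fun k q => (sel (nxt k q) (et (k+1)), nxt k q)) n
  let x : ℕ → Y := fun k => (st k).1
  let P : ℕ → Y → ℝ := fun k => (st k).2
  have hP0 : P 0 = 0 := rfl
  have hPs : ∀ k y, P (k+1) y = P k y + μ k * s k (y - x k) := fun k y => rfl
  have hxs : ∀ k, x k = sel (P k) (et k) := by
    intro k; cases k <;> rfl
  have hPnn : ∀ k y, 0 ≤ P k y := by
    intro k
    induction k with
    | zero => intro y; rw [hP0]; simp
    | succ k ih => intro y; rw [hPs]; have := ih y; have := hpos k (y - x k)
                   have := hμ k; positivity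
  have hxD : ∀ k, x k ∈ D := fun k => by rw [hxs]; exact (hsel _ _ (hPnn k) (het k)).1
  have hxm : ∀ k, ∀ y ∈ D, g (x k) + P k (x k) ≤ g y + P k y + et k := fun k => by
    have := (hsel _ _ (hPnn k) (het k)).2
    rw [← hxs] at this; exact this
  have hPk : ∀ k, P (k+1) (x k) = P k (x k) := fun k => by rw [hPs]; simp [hzero]
  have hmu_et : ∀ k, et k = μ k * (η / (2*δ) * (1/2)^k) := by
    intro k
    simp only [et, μ]
    have : (1/4 : ℝ)^k = (1/2)^k * (1/2)^k := by rw [← mul_pow]; norm_num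
    rw [this]; field_simp; ring
  have hdist : ∀ k, dist (x k) (x (k+1)) ≤ (1 + 2 * (η / (2*δ))) * (1/2)^k := by
    intro k
    have h1 := hxm k _ (hxD (k+1))
    have h2 := hxm (k+1) _ (hxD k)
    rw [hPk, hPs] at h2
    have h3 : et (k+1) ≤ et k := by
      simp only [et]; rw [pow_succ]
      have : 0 < η / 4 * (1/4)^k := het k
      linarith
    have h4 : μ k * s k (x (k+1) - x k) ≤ μ k * (2 * (η / (2*δ) * (1/2)^k)) := by
      have := hmu_et k
      linarith
    have h5 := le_of_mul_le_mul_left h4 (hμ k)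
    have h6 := hge k (x (k+1) - x k)
    rw [dist_comm, dist_eq_norm]
    linarith
  obtain ⟨xb, hxb⟩ := cauchySeq_tendsto_of_complete
    (cauchySeq_of_le_geometric (1/2 : ℝ) _ (by norm_num) hdist)
  -- the sum
  let G : Y → ℝ := fun y => ∑' k, μ k * s k (y - x k)
  have hμsum : HasSum μ δ := by
    have := hasSum_geometric_two.mul_left (δ/2)
    rw [div_mul_cancel₀ δ two_ne_zero] at this; exact this
  have hub : ∀ k y, s k y ≤ ‖y‖ := by
    intro k y
    have h1 := hsub k y 0
    rw [hzero, zero_sub, map_neg] at h1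
    have h2 := (le_abs_self _).trans ((s' k y).le_opNorm y)
    have h3 := hn k y
    nlinarith [norm_nonneg y]
  obtain ⟨R, hR⟩ := (Metric.isBounded_range_of_tendsto x hxb).exists_norm_le
  have hRx : ∀ k, ‖x k‖ ≤ R := fun k => hR _ ⟨k, rfl⟩
  have hsum : ∀ y, Summable (fun k => μ k * s k (y - x k)) := by
    intro y
    refine Summable.of_nonneg_of_le (fun k => mul_nonneg (hμ k).le (hpos _ _)) (fun k => ?_)
      (hμsum.summable.mul_right (‖y‖ + R))
    have := (hub k (y - x k)).trans ((norm_sub_le _ _).trans (add_le_add_right (hRx k) _))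
    exact mul_le_mul_of_nonneg_left this (hμ k).le
  have hPsum : ∀ k y, P k y = ∑ i ∈ Finset.range k, μ i * s i (y - x i) := by
    intro k y
    induction k with
    | zero => simp [hP0]
    | succ k ih => rw [hPs, ih, Finset.sum_range_succ]
  have hPG : ∀ k y, P k y ≤ G y := by
    intro k y; rw [hPsum]
    exact (hsum y).sum_le_tsum _ (fun k _ => mul_nonneg (hμ k).le (hpos _ _))
  have hPlim : ∀ y, Tendsto (fun k => P k y) atTop (𝓝 (G y)) := by
    intro y
    simp_rw [hPsum]
    exact (hsum y).hasSum.tendsto_sum_nat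
  have hPmono : ∀ y, Monotone (fun k => P k y) := by
    intro y
    refine monotone_nat_of_le_succ (fun k => ?_)
    rw [hPs]
    have := mul_nonneg (hμ k).le (hpos k (y - x k))
    linarith
  have hPcont : ∀ k, Continuous (P k) := by
    intro k
    have : P k = fun y => ∑ i ∈ Finset.range k, μ i * s i (y - x i) := funext (hPsum k)
    rw [this]
    refine continuous_finset_sum _ (fun i _ => continuous_const.mul ?_)
    have hc : Continuous (s i) := continuous_iff_continuousAt.mpr (fun z => (hd i z).continuousAt)
    exact hc.comp (continuous_id.sub continuous_const)
  have hder : HasFDerivAt G (∑' k, μ k • s' k (xb - x k)) xb := by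
    refine hasFDerivAt_tsum (f' := fun k y => μ k • s' k (y - x k)) hμsum.summable
      (fun k y => ?_) (fun k y => ?_) (hsum xb) xb
    · have h1 : HasFDerivAt (fun z => s k (z - x k)) (s' k (y - x k)) y := by
        have := (hd k (y - x k)).comp y ((hasFDerivAt_id y).sub_const (x k))
        rw [ContinuousLinearMap.comp_id] at this; exact this
      exact h1.const_mul (μ k)
    · rw [norm_smul, Real.norm_of_nonneg (hμ k).le]
      have := hn k (y - x k); have := hμ k
      nlinarith
  have hderb : ‖∑' k, μ k • s' k (xb - x k)‖ ≤ δ := by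
    refine tsum_of_norm_bounded hμsum (fun k => ?_)
    rw [norm_smul, Real.norm_of_nonneg (hμ k).le]
    have := hn k (xb - x k); have := hμ k
    nlinarith
  have hetlim : Tendsto et atTop (𝓝 0) := by
    have := (tendsto_pow_atTop_nhds_zero_of_lt_one (r := (1/4:ℝ)) (by norm_num)
      (by norm_num)).const_mul (η/4)
    simpa [et] using this
  have hmin : ∀ y ∈ D, ∀ k, xb ∈ D ∧ g xb + P k xb ≤ g y + G y := by
    intro y hy k
    have key : ∀ e > 0, xb ∈ D ∧ g xb + P k xb ≤ g y + G y + e := by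
      intro e he
      refine closed_add_cont D g hcl (P k) (hPcont k) x xb hxb _ ?_
      filter_upwards [eventually_ge_atTop k, hetlim.eventually (gt_mem_nhds he)] with j hj hj2
      refine ⟨hxD j, ?_⟩
      have h1 := hxm j y hy
      have h2 := hPG j y
      have h3 : P k (x j) ≤ P j (x j) := hPmono (x j) hj
      linarith
    exact ⟨(key 1 one_pos).1, le_of_forall_pos_le_add (fun e he => (key e he).2)⟩
  refine ⟨xb, G, _, (hmin x0 hx0 0).1, hder, hderb, ?_, ?_⟩
  · intro y hy
    exact le_of_tendsto' ((hPlim xb).const_add (g xb)) (fun k => (hmin y hy k).2)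
  · have ha : ∀ j, g (x j) + P j (x j) ≤ g x0 + η * (1 - (1/4)^j / 2) := by
      intro j
      induction j with
      | zero =>
        have := hxm 0 x0 hx0
        have h0 : et 0 = η/4 := by simp [et]
        rw [hP0, h0] at this
        rw [hP0]
        simp only [Pi.zero_apply] at *
        norm_num
        linarith
      | succ j ih =>
        have h1 := hxm (j+1) _ (hxD j)
        rw [hPk] at h1
        have h2 : et (j+1) = η * ((1/4)^j / 16) := by simp only [et]; rw [pow_succ]; ring
        rw [h2] at h1
        rw [pow_succ]
        have : 0 < η * (1/4:ℝ)^j := by positivity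
        nlinarith
    have := closed_add_cont D g hcl 0 continuous_zero x xb hxb (g x0 + η) (by
      refine Eventually.of_forall (fun j => ⟨hxD j, ?_⟩)
      have h1 := ha j
      have h2 := hPnn j (x j)
      have : 0 < η * (1/4:ℝ)^j := by positivity
      simp only [Pi.zero_apply]
      nlinarith)
    simpa using this.2
end svp

section mvt
variable {Y : Type*} [NormedAddCommGroup Y] [NormedSpace ℝ Y]

theorem mvt_gauge [CompleteSpace Y] (hS : SmoothGauge Y) (f : Y → EReal)
    (hnb : ∀ x, f x ≠ ⊥) (hlsc : LowerSemicontinuous f) (a b : Y) (s : ℝ) (hs0 : 0 < s)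
    (hs1 : s < 1) (hlt : f a < f (a + s • (b - a))) (ε : ℝ) (hε : 0 < ε) :
    ∃ u : Y, ∃ t : ℝ, 0 ≤ t ∧ t ≤ s ∧ ‖u - (a + t • (b - a))‖ < ε ∧
      ∃ ξ ∈ FrechetSubdiff f u, 0 < ξ (b - u) := by
  set d := b - a with hd
  let c : ℝ → Y := fun t => a + t • d
  have hcc : Continuous c := by fun_prop
  let seg : Set Y := c '' Set.Icc 0 s
  have hseg : IsCompact seg := isCompact_Icc.image hcc
  have haseg : a ∈ seg := ⟨0, ⟨le_rfl, hs0.le⟩, by simp [c]⟩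
  let g0 : Y → ℝ := fun x => (f x).toReal
  have hg0 : ∀ x, f x ≠ ⊤ → f x = (g0 x : EReal) := fun x hx => (EReal.coe_toReal hx (hnb x)).symm
  have hatop : f a ≠ ⊤ := ne_top_of_lt hlt
  -- lower bound near the segment
  obtain ⟨p, hp, hpm⟩ := (hlsc.lowerSemicontinuousOn seg).exists_isMinOn ⟨a, haseg⟩ hseg
  have hpa : f p ≤ f a := hpm haseg
  have hptop : f p ≠ ⊤ := ne_top_of_le_ne_top hatop hpa
  set m : ℝ := g0 p - 1 with hm
  have hUo : IsOpen (f ⁻¹' Set.Ioi (m : EReal)) := hlsc.isOpen_preimage _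
  have hsegU : seg ⊆ f ⁻¹' Set.Ioi (m : EReal) := by
    intro x hx
    have h1 : f p ≤ f x := hpm hx
    rw [hg0 p hptop] at h1
    exact lt_of_lt_of_le (EReal.coe_lt_coe_iff.mpr (by linarith)) h1
  obtain ⟨r0, hr0, hthick⟩ := hseg.exists_cthickening_subset_open hUo hsegU
  let D : Set Y := {x | x ∈ Metric.cthickening r0 seg ∧ f x ≠ ⊤}
  have hDm : ∀ x ∈ D, m ≤ g0 x := by
    intro x hx
    have h1 : (m : EReal) < f x := hthick hx.1
    rw [hg0 x hx.2] at h1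
    exact (EReal.coe_lt_coe_iff.mp h1).le
  have hDcl : ∀ L : ℝ, IsClosed {x | x ∈ D ∧ g0 x ≤ L} := by
    intro L
    have : {x | x ∈ D ∧ g0 x ≤ L} = Metric.cthickening r0 seg ∩ f ⁻¹' Set.Iic (L : EReal) := by
      ext x
      constructor
      · rintro ⟨⟨h1, h2⟩, h3⟩
        refine ⟨h1, ?_⟩
        show f x ≤ L
        rw [hg0 x h2]; exact EReal.coe_le_coe_iff.mpr h3
      · rintro ⟨h1, h2⟩
        have h2' : f x ≤ L := h2
        have h3 : f x ≠ ⊤ := ne_top_of_le_ne_top (EReal.coe_ne_top L) h2'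
        refine ⟨⟨h1, h3⟩, ?_⟩
        rw [hg0 x h3] at h2'
        exact EReal.coe_le_coe_iff.mp h2'
    rw [this]
    exact Metric.isClosed_cthickening.inter (hlsc.isClosed_preimage _)
  have haD : a ∈ D := ⟨Metric.self_subset_cthickening seg haseg, hatop⟩
  -- level above f a near z
  obtain ⟨r, hr1, hr2⟩ := EReal.lt_iff_exists_real_btwn.mp hlt
  have har : g0 a < r := by rw [hg0 a hatop] at hr1; exact EReal.coe_lt_coe_iff.mp hr1
  have hzn : f ⁻¹' Set.Ioi (r : EReal) ∈ 𝓝 (c s) := (hlsc.isOpen_preimage _).mem_nhds hr2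
  obtain ⟨rz, hrz, hball⟩ := Metric.mem_nhds_iff.mp hzn
  set ρ := (r - g0 a) / 3 with hρ
  have hρ0 : 0 < ρ := by rw [hρ]; linarith
  set κ := ρ / s with hκ
  have hκ0 : 0 < κ := by positivity
  have hκs : κ * s = ρ := by rw [hκ]; field_simp
  set rad := min (min ε r0) (min rz 1) with hrad
  have hrad0 : 0 < rad := by positivity
  have hC : 0 < g0 a + 2 * ρ - m := by
    have := hDm a haD
    linarith
  set C := g0 a + 2 * ρ - m with hCdef
  set n := 4 * C / rad with hn
  have hn0 : 0 < n := by positivity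
  obtain ⟨σ, σ', hder, hnorm, hpos, hzero, hge, hsub⟩ := hS (rad / 2) (by positivity)
  have hlip : ∀ x y, σ x ≤ σ y + ‖x - y‖ := by
    intro x y
    have h1 := hsub x y
    have h2 := (neg_abs_le _).trans' (neg_le_neg ((σ' x).le_opNorm (y - x)))
    have h3 := hnorm x
    rw [norm_sub_rev]
    nlinarith [norm_nonneg (y - x)]
  have hσc : Continuous σ := continuous_iff_continuousAt.mpr (fun z => (hder z).continuousAt)
  have hT : ∀ x, ∃ t ∈ Set.Icc 0 s, ∀ t' ∈ Set.Icc 0 s,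
      n * σ (x - c t) - κ * t ≤ n * σ (x - c t') - κ * t' := by
    intro x
    have : Continuous (fun t => n * σ (x - c t) - κ * t) := by fun_prop
    obtain ⟨t, ht, htm⟩ := isCompact_Icc.exists_isMinOn ⟨0, ⟨le_rfl, hs0.le⟩⟩
      this.continuousOn (s := Set.Icc 0 s)
    exact ⟨t, ht, fun t' ht' => htm ht'⟩
  choose T hTm hTmin using hT
  let om : Y → ℝ := fun x => n * σ (x - c (T x)) - κ * T x
  have homc : Continuous om := by
    refine (LipschitzWith.of_le_add_mul ⟨n, hn0.le⟩ (fun x y => ?_)).continuous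
    have h1 := hTmin x (T y) (hTm y)
    have h2 := hlip (x - c (T y)) (y - c (T y))
    rw [sub_sub_sub_cancel_right] at h2
    have h3 := mul_le_mul_of_nonneg_left h2 hn0.le
    rw [dist_eq_norm]
    show n * σ (x - c (T x)) - κ * T x ≤ n * σ (y - c (T y)) - κ * T y + n * ‖x - y‖
    linarith
  have hom_ge : ∀ x, -ρ ≤ om x := by
    intro x
    have h1 := mul_nonneg hn0.le (hpos (x - c (T x)))
    have h2 := mul_le_mul_of_nonneg_left (hTm x).2 hκ0.le
    show -ρ ≤ n * σ (x - c (T x)) - κ * T x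
    linarith
  have homa : om a ≤ 0 := by
    have := hTmin a 0 ⟨le_rfl, hs0.le⟩
    have hc0 : a - c 0 = 0 := by simp [c]
    rw [hc0, hzero] at this
    show n * σ (a - c (T a)) - κ * T a ≤ 0
    linarith
  have hgcl : ∀ L : ℝ, IsClosed {x | x ∈ D ∧ g0 x + om x ≤ L} := by
    intro L
    refine IsSeqClosed.isClosed (fun u x hu hux => ?_)
    exact closed_add_cont D g0 hDcl om homc u x hux L (Eventually.of_forall hu)
  have hδ : ∃ δ > 0, δ * ‖d‖ ≤ κ / 2 ∧ δ ≤ (1 - s) * κ / 4 := by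
    refine ⟨min (κ / 2 / (‖d‖ + 1)) ((1 - s) * κ / 4), ?_, ?_, min_le_right _ _⟩
    · have : 0 < 1 - s := by linarith
      positivity
    · calc _ ≤ (κ / 2 / (‖d‖ + 1)) * (‖d‖ + 1) := by
            gcongr
            · exact min_le_left _ _
            · linarith
        _ = κ / 2 := by field_simp
  obtain ⟨δ, hδ0, hδ1, hδ2⟩ := hδ
  obtain ⟨xb, G, G', hxD, hG, hGn, hmin, hval⟩ := svp hS D (fun x => g0 x + om x) (m - ρ)
    (fun x hx => by have := hDm x hx; have := hom_ge x; show m - ρ ≤ g0 x + om x; linarith)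
    hgcl a haD δ ρ hδ0 hρ0
  set t := T xb with ht
  set w := xb - c t with hw
  have homx : om xb = n * σ w - κ * t := rfl
  have ht0 : 0 ≤ t := (hTm xb).1
  have hts : t ≤ s := (hTm xb).2
  have hκt : κ * t ≤ ρ := by rw [← hκs]; gcongr
  have hwn : ‖w‖ < rad := by
    have h1 : n * σ w ≤ C := by
      have := hDm xb hxD
      linarith
    have h2 : n * (‖w‖ - rad / 2) ≤ n * (rad / 4) := by
      have h3 : n * (rad / 4) = C := by rw [hn]; field_simp
      rw [h3]
      exact (mul_le_mul_of_nonneg_left (hge w) hn0.le).trans h1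
    have := le_of_mul_le_mul_left h2 hn0
    linarith
  have hw1 : ‖w‖ < ε := hwn.trans_le ((min_le_left _ _).trans (min_le_left _ _))
  have hw2 : ‖w‖ < r0 := hwn.trans_le ((min_le_left _ _).trans (min_le_right _ _))
  have hw3 : ‖w‖ < rz := hwn.trans_le ((min_le_right _ _).trans (min_le_left _ _))
  have hw4 : ‖w‖ < 1 := hwn.trans_le ((min_le_right _ _).trans (min_le_right _ _))
  have htlt : t < s := by
    refine lt_of_le_of_ne hts (fun hh => ?_)
    have h1 : xb ∈ Metric.ball (c s) rz := by
      rw [mem_ball_iff_norm, ← hh]; exact hw3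
    have h2 : (r : EReal) < f xb := hball h1
    rw [hg0 xb hxD.2] at h2
    have h3 := EReal.coe_lt_coe_iff.mp h2
    have h4 := mul_nonneg hn0.le (hpos w)
    have : r = g0 a + 3 * ρ := by rw [hρ]; ring
    linarith
  have hslope : κ ≤ n * σ' w (-d) := by
    have h1 : HasDerivAt (fun τ : ℝ => w - τ • d) (-d) 0 := by
      have := ((hasDerivAt_id (0:ℝ)).smul_const d).const_sub w
      simpa using this
    have h2 : HasDerivAt (fun τ : ℝ => σ (w - τ • d)) (σ' w (-d)) 0 := by
      refine HasFDerivAt.comp_hasDerivAt (0:ℝ) ?_ h1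
      simpa using hder w
    have h3 : HasDerivAt (fun τ : ℝ => n * σ (w - τ • d) - κ * τ) (n * σ' w (-d) - κ) 0 := by
      have := (h2.const_mul n).sub ((hasDerivAt_id (0:ℝ)).const_mul κ)
      rw [mul_one] at this
      exact this
    have h4 := (hasDerivWithinAt_iff_tendsto_slope' (s := Set.Ioi (0:ℝ)) (by simp)).mp
      h3.hasDerivWithinAt
    have h5 : 0 ≤ n * σ' w (-d) - κ := by
      refine ge_of_tendsto h4 ?_
      have h6 : Set.Ioo 0 (s - t) ∈ 𝓝[>] (0:ℝ) := Ioo_mem_nhdsGT (by linarith)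
      filter_upwards [h6] with τ hτ
      rw [slope_def_field]
      have h7 := hTmin xb (t + τ) ⟨by linarith [hτ.1], by linarith [hτ.2]⟩
      have h8 : xb - c (t + τ) = w - τ • d := by
        simp only [hw, c]; module
      rw [h8] at h7
      refine div_nonneg ?_ (by linarith [hτ.1])
      simp only [zero_smul, sub_zero, mul_zero]
      change n * σ w - κ * t ≤ _ at h7
      linarith
    linarith
  refine ⟨xb, t, ht0, hts, hw1, -(n • σ' w) - G', ⟨hxD.2, ?_⟩, ?_⟩
  · intro e he
    have h1 : HasFDerivAt (fun z => σ (z - c t)) (σ' w) xb := by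
      have := (hder (xb - c t)).comp xb ((hasFDerivAt_id xb).sub_const (c t))
      rw [ContinuousLinearMap.comp_id] at this; exact this
    have h2 := ((h1.const_mul n).add hG).isLittleO
    have h3 := Asymptotics.isLittleO_iff.mp h2 he
    have h4 : Metric.cthickening r0 seg ∈ 𝓝 xb := by
      have h5 : Metric.ball (c t) r0 ∈ 𝓝 xb :=
        Metric.isOpen_ball.mem_nhds (by rw [mem_ball_iff_norm]; exact hw2)
      refine mem_of_superset h5 ?_
      have hcts : c t ∈ seg := ⟨t, ⟨ht0, hts⟩, rfl⟩
      exact (Metric.ball_subset_thickening hcts r0).trans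
        (Metric.thickening_subset_cthickening _ _)
    filter_upwards [h3, h4] with y hy hy2
    by_cases hyt : f y = ⊤
    · rw [hyt]; exact le_top
    have h6 := hmin y ⟨hy2, hyt⟩
    have h7 : om y ≤ n * σ (y - c t) - κ * t := hTmin y t ⟨ht0, hts⟩
    rw [homx] at h6
    rw [Real.norm_eq_abs, abs_le] at hy
    have h8 := hy.2
    simp only [Pi.add_apply, _root_.add_apply, _root_.smul_apply, smul_eq_mul] at h8
    rw [← hw] at h8
    rw [hg0 xb hxD.2, hg0 y hyt, ← EReal.coe_add, ← EReal.coe_sub, EReal.coe_le_coe_iff]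
    simp only [_root_.sub_apply, _root_.neg_apply, _root_.smul_apply, smul_eq_mul]
    linarith
  · have hb : b - xb = (1 - t) • d - w := by
      simp only [hw, c, hd]; module
    rw [hb, map_sub, map_smul]
    simp only [_root_.sub_apply, _root_.neg_apply, _root_.smul_apply, smul_eq_mul]
    rw [map_neg] at hslope
    have h1 : 0 ≤ σ' w w := by
      have h2 := hsub w 0
      rw [hzero, zero_sub, map_neg] at h2
      linarith [hpos w]
    have h3 := mul_nonneg hn0.le h1
    have h4 : |G' d| ≤ κ / 2 :=
      (G'.le_opNorm d).trans ((mul_le_mul_of_nonneg_right hGn (norm_nonneg d)).trans hδ1)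
    have h5 : |G' w| ≤ (1 - s) * κ / 4 := by
      refine (G'.le_opNorm w).trans ?_
      calc _ ≤ δ * 1 := by gcongr
        _ ≤ _ := by linarith
    have h6 := (abs_le.mp h4).2
    have h7 := (abs_le.mp h5).1
    have h8 : (1 - s) * (κ / 2) ≤ (1 - t) * (-(n * σ' w d) - G' d) := by
      have : κ / 2 ≤ -(n * σ' w d) - G' d := by linarith
      have h9 : 1 - s ≤ 1 - t := by linarith
      have h10 : 0 < 1 - s := by linarith
      exact mul_le_mul h9 this (by linarith) (by linarith)
    have h11 : 0 < (1 - s) * κ := mul_pos (by linarith) hκ0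
    nlinarith
end mvt

section sepred
variable {X : Type*} [NormedAddCommGroup X] [NormedSpace ℝ X]

/-- A finite configuration `(z, s)` witnessing the failure of an inequality. -/
def Viol (f : X → EReal) {N : ℕ} (lam rho ep : Fin N → ℝ) (u y : X) (c q : ℝ)
    (z : Fin N → X) (s : Fin N → ℝ) : Prop :=
  (∀ i, ‖z i - u‖ < rho i) ∧ (∀ i, f (z i) ≤ (s i : EReal)) ∧
    ∑ i, lam i * (s i + ep i * ‖z i - u‖) + c * ‖∑ i, lam i • z i - y‖ < q

theorem viol_open (f : X → EReal) {N : ℕ} {P : Type*} [TopologicalSpace P]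
    (lam rho ep : P → Fin N → ℝ) (u y : P → X) (c q : P → ℝ)
    (h1 : Continuous lam) (h2 : Continuous rho) (h3 : Continuous ep)
    (h4 : Continuous u) (h5 : Continuous y) (h6 : Continuous c) (h7 : Continuous q)
    (z : Fin N → X) (s : Fin N → ℝ) :
    IsOpen {p : P | Viol f (lam p) (rho p) (ep p) (u p) (y p) (c p) (q p) z s} := by
  have e : {p : P | Viol f (lam p) (rho p) (ep p) (u p) (y p) (c p) (q p) z s} =
      (⋂ i, {p : P | ‖z i - u p‖ < rho p i}) ∩ ({p : P | ∀ i, f (z i) ≤ (s i : EReal)} ∩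
       {p : P | ∑ i, lam p i * (s i + ep p i * ‖z i - u p‖)
          + c p * ‖∑ i, lam p i • z i - y p‖ < q p}) := by
    ext p
    simp [Viol]
  rw [e]
  refine (isOpen_iInter_of_finite fun i => ?_).inter (isOpen_const.inter ?_)
  · exact isOpen_lt (by fun_prop) (by fun_prop)
  · exact isOpen_lt (by fun_prop) (by fun_prop)

theorem viol_step (f : X → EReal) (S : Submodule ℝ X)
    (hS : TopologicalSpace.IsSeparable (S : Set X)) :
    ∃ S' : Submodule ℝ X, TopologicalSpace.IsSeparable (S' : Set X) ∧ S ≤ S' ∧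
      ∀ (N : ℕ) (lam rho ep : Fin N → ℝ) (u y : X) (c q : ℝ), u ∈ S → y ∈ S →
        (∃ z s, Viol f lam rho ep u y c q z s) →
        ∃ z s, (∀ i, z i ∈ S') ∧ Viol f lam rho ep u y c q z s := by
  have hsep : TopologicalSpace.SeparableSpace S := hS.separableSpace
  have h2c : SecondCountableTopology S := UniformSpace.secondCountable_of_separable S
  have key : ∀ N : ℕ, ∃ T : Set ((Fin N → X) × (Fin N → ℝ)), T.Countable ∧
      ∀ (lam rho ep : Fin N → ℝ) (u y : X) (c q : ℝ), u ∈ S → y ∈ S →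
        (∃ z s, Viol f lam rho ep u y c q z s) →
        ∃ w ∈ T, Viol f lam rho ep u y c q w.1 w.2 := by
    intro N
    let O : (Fin N → X) × (Fin N → ℝ) → Set ((Fin N → ℝ) × (Fin N → ℝ) × (Fin N → ℝ) × S × S × ℝ × ℝ) := fun w =>
      {p | Viol f p.1 p.2.1 p.2.2.1 (p.2.2.2.1 : X) (p.2.2.2.2.1 : X) p.2.2.2.2.2.1
        p.2.2.2.2.2.2 w.1 w.2}
    obtain ⟨T, hT, hTU⟩ := TopologicalSpace.isOpen_iUnion_countable O (fun w => by
      apply viol_open f (P := (Fin N → ℝ) × (Fin N → ℝ) × (Fin N → ℝ) × S × S × ℝ × ℝ) (fun p => p.1) (fun p => p.2.1) (fun p => p.2.2.1)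
        (fun p => (p.2.2.2.1 : X)) (fun p => (p.2.2.2.2.1 : X))
        (fun p => p.2.2.2.2.2.1) (fun p => p.2.2.2.2.2.2) <;> fun_prop)
    refine ⟨T, hT, ?_⟩
    rintro lam rho ep u y c q hu hy ⟨z, s, hv⟩
    let p : (Fin N → ℝ) × (Fin N → ℝ) × (Fin N → ℝ) × S × S × ℝ × ℝ := (lam, rho, ep, ⟨u, hu⟩, ⟨y, hy⟩, c, q)
    have hp : p ∈ ⋃ w, O w := Set.mem_iUnion.mpr ⟨(z, s), hv⟩
    rw [← hTU] at hp
    obtain ⟨w, hw, hpw⟩ := Set.mem_iUnion₂.mp hp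
    exact ⟨w, hw, hpw⟩
  choose T hTc hT using key
  let Z : Set X := ⋃ N, ⋃ w ∈ T N, Set.range w.1
  have hZ : Z.Countable :=
    Set.countable_iUnion fun N => (hTc N).biUnion fun w _ => Set.countable_range _
  refine ⟨Submodule.span ℝ ((S : Set X) ∪ Z), ?_, ?_, ?_⟩
  · exact (hS.union hZ.isSeparable).span (R := ℝ)
  · exact fun x hx => Submodule.subset_span (Or.inl hx)
  · intro N lam rho ep u y c q hu hy hv
    obtain ⟨w, hw, hwv⟩ := hT N lam rho ep u y c q hu hy hv
    refine ⟨w.1, w.2, fun i => Submodule.subset_span (Or.inr ?_), hwv⟩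
    exact Set.mem_iUnion.mpr ⟨N, Set.mem_iUnion₂.mpr ⟨w, hw, ⟨i, rfl⟩⟩⟩

theorem viol_closed (f : X → EReal) (a b : X) :
    ∃ Y : Submodule ℝ X, IsClosed (Y : Set X) ∧ TopologicalSpace.IsSeparable (Y : Set X) ∧
      a ∈ Y ∧ b ∈ Y ∧
      ∀ (N : ℕ) (lam rho ep : Fin N → ℝ) (u y : X) (c q : ℝ), u ∈ Y → y ∈ Y →
        (∀ i, 0 ≤ lam i) → (∀ i, 0 ≤ ep i) → 0 ≤ c →
        (∃ z s, Viol f lam rho ep u y c q z s) →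
        ∃ z s, (∀ i, z i ∈ Y) ∧ Viol f lam rho ep u y c q z s := by
  choose! st hst1 hst2 hst3 using viol_step f
  obtain ⟨S, hS0, hSs⟩ : ∃ S : ℕ → Submodule ℝ X, S 0 = Submodule.span ℝ ({a, b} : Set X) ∧
      ∀ k, S (k + 1) = st (S k) :=
    ⟨fun k => Nat.rec (Submodule.span ℝ ({a, b} : Set X)) (fun _ T => st T) k, rfl, fun _ => rfl⟩
  have hsep : ∀ k, TopologicalSpace.IsSeparable (S k : Set X) := by
    intro k
    induction k with
    | zero => rw [hS0]; exact ((Set.toFinite {a, b}).countable.isSeparable).span (R := ℝ)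
    | succ k ih => rw [hSs]; exact hst1 _ ih
  have hmono : Monotone S := monotone_nat_of_le_succ fun k => by
    rw [hSs]; exact hst2 _ (hsep k)
  have hcoe : ((⨆ k, S k : Submodule ℝ X) : Set X) = ⋃ k, (S k : Set X) :=
    Submodule.coe_iSup_of_directed S hmono.directed_le
  have hdense : ∀ x ∈ (⨆ k, S k).topologicalClosure, ∀ η > 0, ∃ k, ∃ x' ∈ S k, ‖x' - x‖ < η := by
    intro x hx η hη
    have hx' : x ∈ closure ((⨆ k, S k : Submodule ℝ X) : Set X) := hx
    rw [hcoe] at hx'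
    obtain ⟨x', hx1, hx2⟩ := Metric.mem_closure_iff.mp hx' η hη
    obtain ⟨k, hk⟩ := Set.mem_iUnion.mp hx1
    exact ⟨k, x', hk, by rwa [dist_comm, dist_eq_norm] at hx2⟩
  have hle : ∀ k, S k ≤ (⨆ k, S k).topologicalClosure := fun k =>
    (le_iSup S k).trans (Submodule.le_topologicalClosure _)
  refine ⟨(⨆ k, S k).topologicalClosure, Submodule.isClosed_topologicalClosure _, ?_,
    hle 0 (by rw [hS0]; exact Submodule.subset_span (by simp)), hle 0 (by rw [hS0]; exact Submodule.subset_span (by simp)), ?_⟩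
  · rw [Submodule.topologicalClosure_coe, hcoe]
    exact (TopologicalSpace.IsSeparable.iUnion hsep).closure
  · rintro N lam rho ep u y c q hu hy hlam hep hc ⟨z, s, hv⟩
    set K : ℝ := ∑ i, lam i * ep i + c with hK
    have ho := viol_open f (P := X × X × ℝ) (fun _ => lam) (fun p i => rho i - p.2.2)
      (fun _ => ep) (fun p => p.1) (fun p => p.2.1) (fun _ => c) (fun p => q - K * p.2.2)
      (by fun_prop) (by fun_prop) (by fun_prop) (by fun_prop) (by fun_prop) (by fun_prop)
      (by fun_prop) z s
    have hm := ho.mem_nhds (x := (u, y, 0)) (by simpa [Set.mem_ofPred_eq] using hv)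
    obtain ⟨r, hr, hball⟩ := Metric.mem_nhds_iff.mp hm
    have hη : 0 < r / 2 := by linarith
    obtain ⟨k1, u', hu', hun⟩ := hdense u hu (r / 2) hη
    obtain ⟨k2, y', hy', hyn⟩ := hdense y hy (r / 2) hη
    set η := r / 2 with hηd
    have hin : ((u', y', η) : X × X × ℝ) ∈ Metric.ball (u, y, (0:ℝ)) r := by
      rw [Metric.mem_ball, Prod.dist_eq, Prod.dist_eq, max_lt_iff, max_lt_iff]
      refine ⟨?_, ?_, ?_⟩
      · rw [dist_eq_norm]; show ‖u' - u‖ < r; linarith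
      · rw [dist_eq_norm]; show ‖y' - y‖ < r; linarith
      · rw [Real.dist_eq, sub_zero, abs_of_pos hη]; show η < r; linarith
    have hv' : Viol f lam (fun i => rho i - η) ep u' y' c (q - K * η) z s := hball hin
    have hu2 : u' ∈ S (max k1 k2) := hmono (le_max_left _ _) hu'
    have hy2 : y' ∈ S (max k1 k2) := hmono (le_max_right _ _) hy'
    obtain ⟨z', s', hz', hw1, hw2, hw3⟩ :=
      hst3 (S (max k1 k2)) (hsep _) N lam _ ep u' y' c _ hu2 hy2 ⟨z, s, hv'⟩
    refine ⟨z', s', fun i => hle (max k1 k2 + 1) (by rw [hSs]; exact hz' i), ?_, hw2, ?_⟩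
    · intro i
      have h1 := hw1 i
      have h2 := norm_add_le (z' i - u') (u' - u)
      rw [sub_add_sub_cancel] at h2
      linarith
    · have e1 : ∑ i, lam i * (s' i + ep i * ‖z' i - u‖) ≤
          ∑ i, lam i * (s' i + ep i * ‖z' i - u'‖) + (∑ i, lam i * ep i) * η := by
        rw [Finset.sum_mul, ← Finset.sum_add_distrib]
        refine Finset.sum_le_sum fun i _ => ?_
        have h2 := norm_add_le (z' i - u') (u' - u)
        rw [sub_add_sub_cancel] at h2
        have h3 : ‖z' i - u‖ ≤ ‖z' i - u'‖ + η := by linarith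
        have h4 := mul_le_mul_of_nonneg_left h3 (mul_nonneg (hlam i) (hep i))
        linarith
      have e2 : ‖∑ i, lam i • z' i - y‖ ≤ ‖∑ i, lam i • z' i - y'‖ + η := by
        have h2 := norm_add_le (∑ i, lam i • z' i - y') (y' - y)
        rw [sub_add_sub_cancel] at h2
        linarith
      have e3 := mul_le_mul_of_nonneg_left e2 hc
      rw [hK] at hw3
      linarith

end sepred

section ext
variable {X : Type*} [NormedAddCommGroup X] [NormedSpace ℝ X]

open scoped NNReal in
theorem extend_subgrad (f : X → EReal) (hnb : ∀ x, f x ≠ ⊥) (Y : Submodule ℝ X)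
    (hY : ∀ (N : ℕ) (lam rho ep : Fin N → ℝ) (u y : X) (c q : ℝ), u ∈ Y → y ∈ Y →
        (∀ i, 0 ≤ lam i) → (∀ i, 0 ≤ ep i) → 0 ≤ c →
        (∃ z s, Viol f lam rho ep u y c q z s) →
        ∃ z s, (∀ i, z i ∈ Y) ∧ Viol f lam rho ep u y c q z s)
    (u : Y) (ξ : Y →L[ℝ] ℝ) (hξ : ξ ∈ FrechetSubdiff (fun y : Y => f y) u) :
    ∃ ξ' ∈ FrechetSubdiff f (u : X), ∀ y : Y, ξ' y = ξ y := by
  obtain ⟨hut, hξ⟩ := hξ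
  change f u ≠ ⊤ at hut
  obtain ⟨t, ht⟩ : ∃ t : ℝ, f u = (t : EReal) := ⟨_, (EReal.coe_toReal hut (hnb _)).symm⟩
  have hδ : ∀ n : ℕ, ∃ δ > 0, ∀ y : Y, ‖y - u‖ < δ →
      ((t + ξ (y - u) - (1 / ((n : ℝ) + 1)) * ‖y - u‖ : ℝ) : EReal) ≤ f y := by
    intro n
    obtain ⟨δ, hδ, h⟩ := Metric.eventually_nhds_iff.mp (hξ (1 / ((n : ℝ) + 1)) (by positivity))
    refine ⟨δ, hδ, fun y hy => ?_⟩
    have := h (y := y) (by rwa [dist_eq_norm])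
    change f u + _ - _ ≤ f y at this
    rw [ht, ← EReal.coe_add, ← EReal.coe_sub] at this
    exact this
  choose δ hδ0 hδ using hδ
  set c := ‖ξ‖ with hc
  have hc0 : 0 ≤ c := norm_nonneg ξ
  let A : Set (X × ℝ) := {p | ∃ n : ℕ, ‖p.1‖ < δ n ∧
    f (u + p.1) ≤ ((t + p.2 - (1 / ((n : ℝ) + 1)) * ‖p.1‖ : ℝ) : EReal)}
  let K : Submodule ℝ≥0 (X × ℝ) := Submodule.span ℝ≥0 A
  have claim : ∀ p ∈ K, ∀ y : Y, ξ y ≤ p.2 + c * ‖p.1 - y‖ := by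
    intro p hp y
    by_contra hcon
    push Not at hcon
    obtain ⟨N, lam, g, rfl⟩ := Submodule.mem_span_set'.mp hp
    have hg : ∀ i, ∃ n : ℕ, ‖(g i : X × ℝ).1‖ < δ n ∧
      f (u + (g i : X × ℝ).1) ≤
        ((t + (g i : X × ℝ).2 - (1 / ((n : ℝ) + 1)) * ‖(g i : X × ℝ).1‖ : ℝ) : EReal) :=
      fun i => (g i).2
    choose n hn1 hn2 using hg
    set L : ℝ := ∑ i, (lam i : ℝ) with hL
    have e1 : (∑ i, lam i • (g i : X × ℝ)).1 = ∑ i, (lam i : ℝ) • (g i : X × ℝ).1 := by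
      rw [Prod.fst_sum]; rfl
    have e2 : (∑ i, lam i • (g i : X × ℝ)).2 = ∑ i, (lam i : ℝ) * (g i : X × ℝ).2 := by
      rw [Prod.snd_sum]; rfl
    rw [e1, e2] at hcon
    obtain ⟨z, s, hz, hv1, hv2, hv3⟩ := hY N (fun i => (lam i : ℝ)) (fun i => δ (n i))
      (fun i => 1 / ((n i : ℝ) + 1)) u (y + L • (u : X)) c (ξ y + L * t) u.2
      (Y.add_mem y.2 (Y.smul_mem _ u.2)) (fun i => (lam i).2) (fun i => by positivity) hc0
      ⟨fun i => u + (g i : X × ℝ).1,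
       fun i => t + (g i : X × ℝ).2 - (1 / ((n i : ℝ) + 1)) * ‖(g i : X × ℝ).1‖, by
        refine ⟨fun i => ?_, fun i => hn2 i, ?_⟩
        · rw [add_sub_cancel_left]; exact hn1 i
        · have h1 : ∑ i, (lam i : ℝ) • ((u : X) + (g i : X × ℝ).1) - (y + L • (u : X)) =
              ∑ i, (lam i : ℝ) • (g i : X × ℝ).1 - y := by
            simp only [smul_add, Finset.sum_add_distrib, ← Finset.sum_smul]
            rw [← hL]; abel
          have h2 : ∑ i, (lam i : ℝ) * (t + (g i : X × ℝ).2 -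
              (1 / ((n i : ℝ) + 1)) * ‖(g i : X × ℝ).1‖ + (1 / ((n i : ℝ) + 1)) *
                ‖(u : X) + (g i : X × ℝ).1 - u‖) =
              L * t + ∑ i, (lam i : ℝ) * (g i : X × ℝ).2 := by
            rw [hL, Finset.sum_mul, ← Finset.sum_add_distrib]
            refine Finset.sum_congr rfl fun i _ => ?_
            rw [add_sub_cancel_left]; ring
          rw [h1, h2]
          linarith⟩
    let z' : Fin N → Y := fun i => ⟨z i, hz i⟩
    have h1 : ∀ i, t + ξ (z' i - u) ≤ s i + 1 / ((n i : ℝ) + 1) * ‖z i - u‖ := by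
      intro i
      have h2 := (hδ (n i) (z' i) (hv1 i)).trans (hv2 i)
      have h3 := EReal.coe_le_coe_iff.mp h2
      have h4 : ‖z' i - u‖ = ‖z i - u‖ := rfl
      rw [h4] at h3
      linarith
    let w : Y := ∑ i, (lam i : ℝ) • z' i - (y + L • u)
    have hw : ‖w‖ = ‖∑ i, (lam i : ℝ) • z i - (y + L • (u : X))‖ := by
      change ‖(w : X)‖ = _
      congr 1
      simp [w, z']
    have h5 : ∑ i, (lam i : ℝ) * (t + ξ (z' i - u)) ≤
        ∑ i, (lam i : ℝ) * (s i + 1 / ((n i : ℝ) + 1) * ‖z i - u‖) :=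
      Finset.sum_le_sum fun i _ => mul_le_mul_of_nonneg_left (h1 i) (lam i).2
    have h6 : ∑ i, (lam i : ℝ) * (t + ξ (z' i - u)) = L * t + ξ w + ξ y := by
      simp only [w, map_sub, map_add, map_sum, map_smul, smul_eq_mul, mul_add, mul_sub,
        Finset.sum_add_distrib, Finset.sum_sub_distrib, ← Finset.sum_mul]
      rw [← hL]; ring
    beta_reduce at hv3
    rw [← hw] at hv3
    have h7 : -(c * ‖w‖) ≤ ξ w := (abs_le.mp (ξ.le_opNorm w)).1
    linarith
  have claim0 : ∀ p ∈ K, ∀ h : X, -(c * ‖h‖) ≤ p.2 + c * ‖h - p.1‖ := by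
    intro p hp h
    have h1 := claim p hp 0
    rw [map_zero] at h1
    have h1' : 0 ≤ p.2 + c * ‖p.1‖ := by simpa using h1
    have h2 : ‖p.1‖ ≤ ‖h‖ + ‖h - p.1‖ := by
      have := norm_sub_le h (h - p.1)
      rwa [sub_sub_cancel] at this
    have := mul_le_mul_of_nonneg_left h2 hc0
    linarith
  let V : X → Set ℝ := fun h => (fun p : X × ℝ => p.2 + c * ‖h - p.1‖) '' (K : Set (X × ℝ))
  have hVb : ∀ h, BddBelow (V h) := by
    intro h
    refine ⟨-(c * ‖h‖), ?_⟩
    rintro _ ⟨p, hp, rfl⟩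
    exact claim0 p hp h
  have hVn : ∀ h, (V h).Nonempty := fun h => ⟨_, ⟨0, K.zero_mem, rfl⟩⟩
  let P : X → ℝ := fun h => sInf (V h)
  have hPle : ∀ p ∈ K, ∀ h, P h ≤ p.2 + c * ‖h - p.1‖ := fun p hp h =>
    csInf_le (hVb h) ⟨p, hp, rfl⟩
  have hPlt : ∀ h, ∀ e > 0, ∃ p ∈ K, p.2 + c * ‖h - p.1‖ < P h + e := by
    intro h e he
    obtain ⟨_, ⟨p, hp, rfl⟩, h2⟩ := exists_lt_of_csInf_lt (hVn h) (show P h < P h + e by linarith)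
    exact ⟨p, hp, h2⟩
  have hom1 : ∀ r : ℝ, 0 < r → ∀ x, P (r • x) ≤ r * P x := by
    intro r hr x
    refine le_of_forall_pos_le_add fun e he => ?_
    obtain ⟨p, hp, h1⟩ := hPlt x (e / r) (by positivity)
    have h2 : P (r • x) ≤ r * p.2 + c * ‖r • x - r • p.1‖ :=
      hPle _ (K.smul_mem (⟨r, hr.le⟩ : ℝ≥0) hp) (r • x)
    rw [← smul_sub, norm_smul, Real.norm_of_nonneg hr.le] at h2
    have h5 := mul_le_mul_of_nonneg_left h1.le hr.le
    have h6 : r * (P x + e / r) = r * P x + e := by field_simp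
    linarith
  have hom : ∀ r : ℝ, 0 < r → ∀ x, P (r • x) = r * P x := by
    intro r hr x
    refine le_antisymm (hom1 r hr x) ?_
    have h1 := hom1 r⁻¹ (by positivity) (r • x)
    rw [inv_smul_smul₀ hr.ne'] at h1
    have h2 := mul_le_mul_of_nonneg_left h1 hr.le
    rwa [mul_inv_cancel_left₀ hr.ne'] at h2
  have hadd : ∀ x y, P (x + y) ≤ P x + P y := by
    intro x y
    refine le_of_forall_pos_le_add fun e he => ?_
    obtain ⟨p, hp, h1⟩ := hPlt x (e / 2) (by positivity)
    obtain ⟨p', hp', h1'⟩ := hPlt y (e / 2) (by positivity)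
    have h2 := hPle _ (K.add_mem hp hp') (x + y)
    rw [Prod.snd_add, Prod.fst_add, add_sub_add_comm] at h2
    have h3 := mul_le_mul_of_nonneg_left (norm_add_le (x - p.1) (y - p'.1)) hc0
    linarith
  obtain ⟨G, hG1, hG2⟩ := exists_extension_of_le_sublinear ⟨Y, (ξ : Y →ₗ[ℝ] ℝ)⟩ P hom hadd (by
    intro y
    refine le_csInf (hVn _) ?_
    rintro _ ⟨p, hp, rfl⟩
    have := claim p hp y
    rw [norm_sub_rev] at this
    exact this)
  have hGle : ∀ x, G x ≤ c * ‖x‖ := by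
    intro x
    have := (hG2 x).trans (hPle 0 K.zero_mem x)
    simpa using this
  have hGb : ∀ x, ‖G x‖ ≤ c * ‖x‖ := by
    intro x
    rw [Real.norm_eq_abs, abs_le]
    have := hGle (-x)
    rw [map_neg, norm_neg] at this
    exact ⟨by linarith, hGle x⟩
  refine ⟨G.mkContinuous c hGb, ⟨hut, ?_⟩, fun y => hG1 y⟩
  intro e he
  obtain ⟨n, hn⟩ := exists_nat_one_div_lt he
  filter_upwards [Metric.ball_mem_nhds (u : X) (hδ0 n)] with x hx
  by_cases hxt : f x = ⊤
  · rw [hxt]; exact le_top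
  obtain ⟨v, hv⟩ : ∃ v : ℝ, f x = (v : EReal) := ⟨_, (EReal.coe_toReal hxt (hnb _)).symm⟩
  rw [mem_ball_iff_norm] at hx
  have hA : ((x - u, v - t + (1 / ((n : ℝ) + 1)) * ‖x - u‖) : X × ℝ) ∈ A := by
    refine ⟨n, hx, ?_⟩
    show f (u + (x - u)) ≤ _
    rw [add_sub_cancel, hv, EReal.coe_le_coe_iff]
    show v ≤ t + (v - t + (1 / ((n : ℝ) + 1)) * ‖x - u‖) - (1 / ((n : ℝ) + 1)) * ‖x - u‖
    linarith
  have h1 := (hG2 (x - u)).trans (hPle _ (Submodule.subset_span hA) (x - u))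
  simp only [sub_self, norm_zero, mul_zero, add_zero] at h1
  have h2 := mul_le_mul_of_nonneg_right hn.le (norm_nonneg (x - (u : X)))
  rw [ht, hv, ← EReal.coe_add, ← EReal.coe_sub, EReal.coe_le_coe_iff, LinearMap.mkContinuous_apply]
  linarith

theorem mvt_asplund [CompleteSpace X] (hX : IsAsplund X) (f : X → EReal)
    (hnb : ∀ x, f x ≠ ⊥) (hlsc : LowerSemicontinuous f) (a b : X) (s : ℝ) (hs0 : 0 < s)
    (hs1 : s < 1) (hlt : f a < f (a + s • (b - a))) (ε : ℝ) (hε : 0 < ε) :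
    ∃ u : X, ∃ t : ℝ, 0 ≤ t ∧ t ≤ s ∧ ‖u - (a + t • (b - a))‖ < ε ∧
      ∃ ξ ∈ FrechetSubdiff f u, 0 < ξ (b - u) := by
  obtain ⟨Y, hYc, hYs, ha, hb, hY⟩ := viol_closed f a b
  have hYsep : TopologicalSpace.SeparableSpace Y := hYs.separableSpace
  have hYcomp : CompleteSpace Y := hYc.completeSpace_coe
  have hS : SmoothGauge Y := smoothGauge_of_separable (hX Y hYc hYsep)
  obtain ⟨u, t, ht0, hts, hn, ξ, hξ, hpos⟩ := mvt_gauge hS (fun y : Y => f y) (fun y => hnb y)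
    (fun y r hr => continuous_subtype_val.continuousAt.eventually (hlsc (y : X) r hr)) ⟨a, ha⟩ ⟨b, hb⟩ s hs0 hs1 hlt ε hε
  obtain ⟨ξ', hξ', he⟩ := extend_subgrad f hnb Y hY u ξ hξ
  refine ⟨u, t, ht0, hts, hn, ξ', hξ', ?_⟩
  rw [← he] at hpos
  exact hpos

end ext

section main
variable {X : Type*} [NormedAddCommGroup X] [NormedSpace ℝ X]

theorem cond_real (φ : X → EReal) (hnobot : ∀ x, φ x ≠ ⊥) (α : ℝ)
    (hcond : ∀ x y : X, φ y ≤ φ x → ∀ xs ∈ FrechetSubdiff φ x,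
      (↑(xs (y - x)) : EReal) ≤ -min (↑(α * ‖y - x‖) : EReal) (φ x - φ y))
    (x y : X) (h : φ y ≤ φ x) (xs : X →L[ℝ] ℝ) (hxs : xs ∈ FrechetSubdiff φ x) :
    xs (y - x) ≤ -min (α * ‖y - x‖) ((φ x).toReal - (φ y).toReal) := by
  have hx : φ x ≠ ⊤ := hxs.1
  have hy : φ y ≠ ⊤ := ne_top_of_le_ne_top hx h
  have h1 := hcond x y h xs hxs
  rw [← EReal.coe_toReal hx (hnobot x), ← EReal.coe_toReal hy (hnobot y), ← EReal.coe_sub] at h1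
  rcases min_choice (α * ‖y - x‖) ((φ x).toReal - (φ y).toReal) with h2 | h2
  · rw [h2]
    rw [min_eq_left (EReal.coe_le_coe_iff.mpr (min_eq_left_iff.mp h2)), ← EReal.coe_neg,
      EReal.coe_le_coe_iff] at h1
    exact h1
  · rw [h2]
    rw [min_eq_right (EReal.coe_le_coe_iff.mpr (min_eq_right_iff.mp h2)), ← EReal.coe_neg,
      EReal.coe_le_coe_iff] at h1
    exact h1

theorem cond_lt (φ : X → EReal) (hnobot : ∀ x, φ x ≠ ⊥) (α : ℝ) (hα : 0 < α)
    (hcond : ∀ x y : X, φ y ≤ φ x → ∀ xs ∈ FrechetSubdiff φ x,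
      (↑(xs (y - x)) : EReal) ≤ -min (↑(α * ‖y - x‖) : EReal) (φ x - φ y))
    (x y : X) (xs : X →L[ℝ] ℝ) (hxs : xs ∈ FrechetSubdiff φ x) (hpos : 0 < xs (y - x)) :
    φ x < φ y := by
  by_contra hcon
  push Not at hcon
  have h1 := cond_real φ hnobot α hcond x y hcon xs hxs
  have hx : φ x ≠ ⊤ := hxs.1
  have h2 := EReal.toReal_le_toReal hcon (hnobot y) hx
  have h3 : 0 ≤ min (α * ‖y - x‖) ((φ x).toReal - (φ y).toReal) :=
    le_min (by positivity) (by linarith)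
  linarith

theorem step_quasi [CompleteSpace X] (hX : IsAsplund X) (φ : X → EReal)
    (hnobot : ∀ x, φ x ≠ ⊥) (hlsc : LowerSemicontinuous φ) (α : ℝ) (hα : 0 < α)
    (hcond : ∀ x y : X, φ y ≤ φ x → ∀ xs ∈ FrechetSubdiff φ x,
      (↑(xs (y - x)) : EReal) ≤ -min (↑(α * ‖y - x‖) : EReal) (φ x - φ y))
    (a b : X) (s : ℝ) (hs0 : 0 < s) (hs1 : s < 1) :
    φ (a + s • (b - a)) ≤ max (φ a) (φ b) := by
  by_contra hcon
  push Not at hcon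
  obtain ⟨ha, hb⟩ := max_lt_iff.mp hcon
  obtain ⟨η, hη, hball⟩ := Metric.mem_nhds_iff.mp
    ((hlsc.isOpen_preimage (φ b)).mem_nhds (show a + s • (b - a) ∈ φ ⁻¹' Set.Ioi (φ b) from hb))
  obtain ⟨u, t, ht0, hts, hn, ξ, hξ, hpos⟩ := mvt_asplund hX φ hnobot hlsc a b s hs0 hs1 ha η hη
  have hub := cond_lt φ hnobot α hα hcond u b ξ hξ hpos
  have h1t : 0 < 1 - t := by linarith
  set θ := (s - t) / (1 - t) with hθ
  have hθ0 : 0 ≤ θ := div_nonneg (by linarith) h1t.le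
  have hθ1 : θ < 1 := by rw [hθ, div_lt_one h1t]; linarith
  have hθm : θ * (1 - t) = s - t := by rw [hθ]; field_simp
  have hz : φ b < φ (u + θ • (b - u)) := by
    apply hball
    rw [mem_ball_iff_norm]
    have hst : s = t + θ * (1 - t) := by linarith
    have e : u + θ • (b - u) - (a + s • (b - a)) = (1 - θ) • (u - (a + t • (b - a))) := by
      rw [hst]; module
    rw [e, norm_smul, Real.norm_of_nonneg (by linarith)]
    nlinarith [norm_nonneg (u - (a + t • (b - a)))]
  have hθpos : 0 < θ := by
    refine lt_of_le_of_ne hθ0 fun h => ?_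
    rw [← h, zero_smul, add_zero] at hz
    exact absurd hz hub.le.not_gt
  have e2 : b + (1 - θ) • (u - b) = u + θ • (b - u) := by module
  obtain ⟨w, τ, hτ0, hτ1, hw, ζ, hζ, hζpos⟩ := mvt_asplund hX φ hnobot hlsc b u (1 - θ)
    (by linarith) (by linarith) (by rw [e2]; exact hz) (θ * ξ (b - u) / (‖ξ‖ + 1)) (by positivity)
  have h1 := cond_lt φ hnobot α hα hcond w u ζ hζ hζpos
  have h2 : 0 < ξ (w - u) := by
    have e3 : w - u = (1 - τ) • (b - u) + (w - (b + τ • (u - b))) := by module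
    rw [e3, map_add, map_smul, smul_eq_mul]
    have h3 := (abs_le.mp (ξ.le_opNorm (w - (b + τ • (u - b))))).1
    have h4 : ‖ξ‖ * ‖w - (b + τ • (u - b))‖ < θ * ξ (b - u) := by
      have h5 : (‖ξ‖ + 1) * (θ * ξ (b - u) / (‖ξ‖ + 1)) = θ * ξ (b - u) := by field_simp
      calc ‖ξ‖ * ‖w - (b + τ • (u - b))‖ ≤ (‖ξ‖ + 1) * ‖w - (b + τ • (u - b))‖ := by
            gcongr; linarith
        _ < (‖ξ‖ + 1) * (θ * ξ (b - u) / (‖ξ‖ + 1)) := by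
            gcongr
        _ = _ := h5
    have h6 : θ * ξ (b - u) ≤ (1 - τ) * ξ (b - u) := by
      gcongr; linarith
    linarith
  have h3 := cond_lt φ hnobot α hα hcond u w ξ hξ h2
  exact absurd h1 h3.le.not_gt

theorem step_robust [CompleteSpace X] (hX : IsAsplund X) (φ : X → EReal)
    (hnobot : ∀ x, φ x ≠ ⊥) (hlsc : LowerSemicontinuous φ) (α : ℝ) (hα : 0 < α)
    (hcond : ∀ x y : X, φ y ≤ φ x → ∀ xs ∈ FrechetSubdiff φ x,
      (↑(xs (y - x)) : EReal) ≤ -min (↑(α * ‖y - x‖) : EReal) (φ x - φ y))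
    (v : X →L[ℝ] ℝ) (hv : ‖v‖ ≤ α)
    (a b : X) (hab : v a ≤ v b) (s : ℝ) (hs0 : 0 < s) (hs1 : s < 1) :
    φ (a + s • (b - a)) + (v (a + s • (b - a)) : EReal) ≤
      max (φ a + (v a : EReal)) (φ b + (v b : EReal)) := by
  by_contra hcon
  push Not at hcon
  let c : ℝ → X := fun t => a + t • (b - a)
  have hcc : Continuous c := by fun_prop
  have hc0 : c 0 = a := by simp [c]
  let g : X → EReal := fun x => φ x + (v x : EReal)
  have hglsc : LowerSemicontinuous g := by
    refine LowerSemicontinuous.add' hlsc ?_ fun x => ?_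
    · exact (continuous_coe_real_ereal.comp v.continuous).lowerSemicontinuous
    · exact EReal.continuousAt_add (Or.inr (EReal.coe_ne_bot _)) (Or.inr (EReal.coe_ne_top _))
  have hgb : ∀ x, g x ≠ ⊥ := fun x => by
    simp only [g, ne_eq, EReal.add_eq_bot_iff, EReal.coe_ne_bot, or_false]; exact hnobot x
  have hgt : ∀ x, g x ≠ ⊤ → φ x ≠ ⊤ := fun x hx h => hx (by
    show φ x + _ = ⊤
    rw [h, EReal.top_add_coe])
  have hreal : ∀ x, φ x ≠ ⊤ → φ x = ((φ x).toReal : EReal) := fun x hx =>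
    (EReal.coe_toReal hx (hnobot x)).symm
  have hgreal : ∀ x, φ x ≠ ⊤ → g x = (((φ x).toReal + v x : ℝ) : EReal) := fun x hx => by
    show φ x + _ = _
    rw [hreal x hx, EReal.toReal_coe, EReal.coe_add]
  obtain ⟨M1, hM1, hM1'⟩ := EReal.lt_iff_exists_real_btwn.mp hcon
  obtain ⟨M2, hM2, hM2'⟩ := EReal.lt_iff_exists_real_btwn.mp hM1'
  obtain ⟨hga, hgb1⟩ := max_lt_iff.mp hM1
  change g a < M1 at hga
  change g b < M1 at hgb1
  change (M2 : EReal) < g (c s) at hM2'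
  have hM12 : M1 < M2 := EReal.coe_lt_coe_iff.mp hM2
  have hat : φ a ≠ ⊤ := hgt a (ne_top_of_lt hga)
  have hbt : φ b ≠ ⊤ := hgt b (ne_top_of_lt hgb1)
  have hvc : ∀ t, v (c t) = v a + t * (v b - v a) := fun t => by simp [c]
  have hφbz : φ b < φ (c s) := by
    by_contra h
    push Not at h
    have h1 : g (c s) ≤ g b := add_le_add h (EReal.coe_le_coe_iff.mpr (by
      rw [hvc]; nlinarith))
    exact absurd (hM2'.trans_le h1) (hgb1.trans hM2).le.not_gt
  have hq := step_quasi hX φ hnobot hlsc α hα hcond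
  -- points between `c t` and `b`
  have hbt' : ∀ t t', t < t' → t' < 1 → φ (c t') ≤ max (φ (c t)) (φ b) := by
    intro t t' h1 h2
    have h1t : 0 < 1 - t := by linarith
    have h3 := hq (c t) b ((t' - t) / (1 - t)) (div_pos (by linarith) h1t)
      (by rw [div_lt_one h1t]; linarith)
    have h4 : (t' - t) / (1 - t) * (1 - t) = t' - t := by field_simp
    have e : c t + ((t' - t) / (1 - t)) • (b - c t) = c t' := by
      have : t' = t + (t' - t) / (1 - t) * (1 - t) := by linarith
      conv_rhs => rw [this]
      simp only [c]; module
    rwa [e] at h3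
  have hlow : ∀ t, t ≤ s → φ b < φ (c t) := by
    intro t h1
    rcases h1.eq_or_lt with h | h
    · rw [h]; exact hφbz
    · rcases le_max_iff.mp (hbt' t s h hs1) with h2 | h2
      · exact hφbz.trans_le h2
      · exact absurd hφbz h2.not_gt
  have hanti : ∀ t t', t < t' → t' ≤ s → φ (c t') ≤ φ (c t) := by
    intro t t' h1 h2
    have h3 := hbt' t t' h1 (by linarith)
    rwa [max_eq_left (hlow t (by linarith)).le] at h3
  have hct : ∀ t, 0 ≤ t → t ≤ s → φ (c t) ≠ ⊤ := by
    intro t h1 h2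
    rcases h1.eq_or_lt with h | h
    · rw [← h, hc0]; exact hat
    · have := hanti 0 t h h2
      rw [hc0] at this
      exact ne_top_of_le_ne_top hat this
  let W : Set ℝ := Set.Icc 0 s ∩ (g ∘ c) ⁻¹' Set.Iic (M2 : EReal)
  have hWc : IsCompact W := by
    refine isCompact_Icc.inter_right ?_
    rw [Set.preimage_comp]
    exact (hglsc.isClosed_preimage _).preimage hcc
  have hWn : W.Nonempty := ⟨0, ⟨le_rfl, hs0.le⟩, by
    show g (c 0) ≤ M2
    rw [hc0]; exact (hga.trans hM2).le⟩
  obtain ⟨t0, ⟨⟨ht00, ht0s⟩, ht0M⟩, hmax⟩ := hWc.exists_isGreatest hWn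
  change g (c t0) ≤ M2 at ht0M
  have ht0lt : t0 < s := lt_of_le_of_ne ht0s fun h => by
    rw [h] at ht0M; exact absurd hM2' ht0M.not_gt
  have hright : ∀ t, t0 < t → t ≤ s → (M2 : EReal) < g (c t) := by
    intro t h1 h2
    by_contra h
    push Not at h
    exact absurd h1 (hmax (⟨⟨by linarith, h2⟩, h⟩ : t ∈ W)).not_gt
  have ht0ge : (M2 : EReal) ≤ g (c t0) := by
    rw [hgreal _ (hct t0 ht00 ht0s), EReal.coe_le_coe_iff]
    by_contra h
    push Not at h
    set gap := M2 - ((φ (c t0)).toReal + v (c t0)) with hgap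
    have hgap0 : 0 < gap := by linarith
    have hD : 0 < v b - v a + 1 := by linarith
    set e := min (s - t0) (gap / (v b - v a + 1)) with he
    have he0 : 0 < e := lt_min (by linarith) (by positivity)
    have he1 : e ≤ s - t0 := min_le_left _ _
    have he2 : e * (v b - v a + 1) ≤ gap := by
      calc _ ≤ gap / (v b - v a + 1) * (v b - v a + 1) := by gcongr; exact min_le_right _ _
        _ = gap := by field_simp
    have h1 := hright (t0 + e) (by linarith) (by linarith)
    have hft := hct (t0 + e) (by linarith) (by linarith)
    rw [hgreal _ hft, EReal.coe_lt_coe_iff] at h1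
    have h2 := EReal.toReal_le_toReal (hanti t0 (t0 + e) (by linarith) (by linarith))
      (hnobot _) (hct t0 ht00 ht0s)
    rw [hvc] at h1
    have h3 := hvc t0
    nlinarith
  have hseg : ∀ t ∈ Set.Icc t0 s, (M1 : EReal) < g (c t) := by
    rintro t ⟨h1, h2⟩
    refine hM2.trans_le ?_
    rcases h1.eq_or_lt with h | h
    · rw [← h]; exact ht0ge
    · exact (hright t h h2).le
  have hUo : IsOpen (g ⁻¹' Set.Ioi (M1 : EReal)) := hglsc.isOpen_preimage _
  obtain ⟨r0, hr0, hthick⟩ := (isCompact_Icc.image hcc (s := Set.Icc t0 s)).exists_thickening_subset_open hUo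
    (by rintro _ ⟨t, ht, rfl⟩; exact hseg t ht)
  have hgbr : (φ b).toReal + v b < M1 := by
    rw [hgreal b hbt, EReal.coe_lt_coe_iff] at hgb1; exact hgb1
  set mg := M1 - ((φ b).toReal + v b) with hmg
  have hmg0 : 0 < mg := by linarith
  have h1t : 0 < 1 - t0 := by linarith
  set θ := (s - t0) / (1 - t0) with hθ
  have hθ0 : 0 < θ := div_pos (by linarith) h1t
  have hθ1 : θ < 1 := by rw [hθ, div_lt_one h1t]; linarith
  have hθm : θ * (1 - t0) = s - t0 := by rw [hθ]; field_simp
  have hce : ∀ τ, c t0 + τ • (b - c t0) = c (t0 + τ * (1 - t0)) := by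
    intro τ; simp only [c]; module
  obtain ⟨u, τ, hτ0, hτ1, hun, ξ, hξ, hpos⟩ := mvt_asplund hX g hgb hglsc (c t0) b θ hθ0 hθ1
    (by rw [hce, hθm, add_sub_cancel]; exact ht0M.trans_lt hM2') (min r0 (mg / (‖v‖ + 1)))
    (lt_min hr0 (by positivity))
  rw [hce] at hun
  set T := t0 + τ * (1 - t0) with hT
  have hT0 : t0 ≤ T := by nlinarith
  have hTs : T ≤ s := by nlinarith
  have hgu : (M1 : EReal) < g u := by
    apply hthick
    rw [Metric.mem_thickening_iff]
    exact ⟨c T, ⟨T, ⟨hT0, hTs⟩, rfl⟩, by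
      rw [dist_eq_norm]; exact hun.trans_le (min_le_left _ _)⟩
  have hut : φ u ≠ ⊤ := hgt u hξ.1
  have hgur : M1 < (φ u).toReal + v u := by
    rw [hgreal u hut, EReal.coe_lt_coe_iff] at hgu; exact hgu
  have hvbu : -mg ≤ v (b - u) := by
    have e : b - u = (b - c T) - (u - c T) := by abel
    have h1 : v (b - c T) = (1 - T) * (v b - v a) := by rw [map_sub, hvc]; ring
    have h2 := (abs_le.mp (v.le_opNorm (u - c T))).2
    have h3 : ‖v‖ * ‖u - c T‖ ≤ mg := by
      calc _ ≤ (‖v‖ + 1) * (mg / (‖v‖ + 1)) := by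
            gcongr
            · linarith
            · exact hun.le.trans (min_le_right _ _)
        _ = mg := by field_simp
    have h4 : 0 ≤ (1 - T) * (v b - v a) := mul_nonneg (by linarith) (by linarith)
    rw [e, map_sub, h1]
    linarith
  have hbu : φ b ≤ φ u := by
    rw [hreal b hbt, hreal u hut, EReal.coe_le_coe_iff]
    rw [map_sub] at hvbu
    linarith
  have hmem : ξ - v ∈ FrechetSubdiff φ u := by
    refine ⟨hut, fun e he => ?_⟩
    filter_upwards [hξ.2 e he] with y hy
    by_cases hyt : φ y = ⊤
    · rw [hyt]; exact le_top
    rw [hgreal u hut, hgreal y hyt, ← EReal.coe_add, ← EReal.coe_sub, EReal.coe_le_coe_iff] at hy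
    rw [hreal u hut, hreal y hyt, ← EReal.coe_add, ← EReal.coe_sub, EReal.coe_le_coe_iff,
      _root_.sub_apply, map_sub v]
    linarith
  have hfin := cond_real φ hnobot α hcond u b hbu (ξ - v) hmem
  rw [_root_.sub_apply] at hfin
  rcases min_choice (α * ‖b - u‖) ((φ u).toReal - (φ b).toReal) with h | h
  · rw [h] at hfin
    have h1 := (abs_le.mp (v.le_opNorm (b - u))).2
    have h2 := mul_le_mul_of_nonneg_right hv (norm_nonneg (b - u))
    linarith
  · rw [h] at hfin
    rw [map_sub v] at hfin
    linarith

end main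

/-- Theorem 3.4, (b) ⇒ (a): in an Asplund space, the first-order condition
`⟨x*, y - x⟩ ≤ -min{α‖y - x‖, φ x - φ y}` whenever `φ y ≤ φ x` and
`x* ∈ ∂̂φ(x)` implies that `φ` is `α`-robustly quasiconvex. -/
theorem subdiff_cond_imp_robustly_quasiconvex
    {X : Type*} [NormedAddCommGroup X] [NormedSpace ℝ X] [CompleteSpace X]
    (hX : IsAsplund X) (φ : X → EReal)
    (hproper : ∃ x, φ x ≠ ⊤) (hnobot : ∀ x, φ x ≠ ⊥)
    (hlsc : LowerSemicontinuous φ)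
    (α : ℝ) (hα : 0 < α)
    (hcond : ∀ x y : X, φ y ≤ φ x → ∀ xs ∈ FrechetSubdiff φ x,
      (↑(xs (y - x)) : EReal) ≤ -min (↑(α * ‖y - x‖) : EReal) (φ x - φ y)) :
    RobustlyQuasiconvex φ α := by
  intro v hv x y l hl0 hl1
  rcases le_total (v x) (v y) with h | h
  · have e : l • x + (1 - l) • y = x + (1 - l) • (y - x) := by module
    show φ (l • x + (1 - l) • y) + _ ≤ _
    rw [e]
    exact step_robust hX φ hnobot hlsc α hα hcond v hv x y h (1 - l) (by linarith) (by linarith)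
  · have e : l • x + (1 - l) • y = y + l • (x - y) := by module
    show φ (l • x + (1 - l) • y) + _ ≤ _
    rw [e, max_comm]
    exact step_robust hX φ hnobot hlsc α hα hcond v hv y x h l hl0 hl1
end

section
/- Let X be an Asplund space, φ : X → ℝ ∪ {+∞} a proper lower semicontinuous function, and α > 0. If φ is α-robustly quasiconvex, then for all x, y ∈ X and all x* ∈ ∂̂φ(x), y* ∈ ∂̂φ(y): if min{⟨x*, y − x⟩, ⟨y*, x − y⟩} > −α‖y − x‖, then ⟨x* − y*, x − y⟩ ≥ 0. -/
open Filter Topology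

lemma exists_gt_of_frechet {X : Type*} [NormedAddCommGroup X] [NormedSpace ℝ X]
    (φ : X → EReal) (hnobot : ∀ x, φ x ≠ ⊥) (x d : X) (xs v : X →L[ℝ] ℝ)
    (hxs : xs ∈ FrechetSubdiff φ x) (hpos : 0 < xs d + v d) :
    ∃ t : ℝ, 0 < t ∧ t < 1 ∧ φ x + ↑(v x) < φ (x + t • d) + ↑(v (x + t • d)) := by
  obtain ⟨hfin, h⟩ := hxs
  have hr : 0 < ‖d‖ + 1 := by positivity
  have hev := h ((xs d + v d) / (2 * (‖d‖ + 1))) (by positivity)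
  have htend : Tendsto (fun t : ℝ => x + t • d) (𝓝[>] 0) (𝓝 x) := by
    have hc : Continuous (fun t : ℝ => x + t • d) := by fun_prop
    have := hc.tendsto 0
    simp only [zero_smul, add_zero] at this
    exact this.mono_left nhdsWithin_le_nhds
  have h1 : ∀ᶠ t : ℝ in 𝓝[>] 0, 0 < t ∧ t < 1 := Ioo_mem_nhdsGT one_pos
  obtain ⟨t, ht, ht0, ht1⟩ := ((htend.eventually hev).and h1).exists
  refine ⟨t, ht0, ht1, ?_⟩
  have key : (xs d + v d) / (2 * (‖d‖ + 1)) * ‖d‖ < xs d + v d := by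
    rw [div_mul_eq_mul_div, div_lt_iff₀ (by positivity)]
    nlinarith [norm_nonneg d]
  have key2 := mul_lt_mul_of_pos_left key ht0
  simp only [add_sub_cancel_left, map_smul, norm_smul, smul_eq_mul, Real.norm_eq_abs,
    abs_of_pos ht0] at ht
  generalize hA : φ x = A at *
  have hAb : A ≠ ⊥ := hA ▸ hnobot x
  generalize hB : φ (x + t • d) = B at *
  have hBb : B ≠ ⊥ := hB ▸ hnobot _
  lift A to ℝ using ⟨hfin, hAb⟩
  by_cases hBt : B = ⊤
  · subst hBt
    rw [EReal.top_add_coe]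
    exact_mod_cast EReal.coe_lt_top _
  lift B to ℝ using ⟨hBt, hBb⟩
  simp only [map_add, map_smul, smul_eq_mul]
  norm_cast at ht ⊢
  nlinarith

/-- Theorem 3.5, necessity: in an Asplund space, if `φ` is `α`-robustly
quasiconvex then for all `x* ∈ ∂̂φ(x)`, `y* ∈ ∂̂φ(y)`,
`min{⟨x*, y - x⟩, ⟨y*, x - y⟩} > -α‖y - x‖` implies `⟨x* - y*, x - y⟩ ≥ 0`. -/
theorem robustly_quasiconvex_imp_pseudomonotone_cond
    {X : Type*} [NormedAddCommGroup X] [NormedSpace ℝ X] [CompleteSpace X]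
    (hX : IsAsplund X) (φ : X → EReal)
    (hproper : ∃ x, φ x ≠ ⊤) (hnobot : ∀ x, φ x ≠ ⊥)
    (hlsc : LowerSemicontinuous φ)
    (α : ℝ) (hα : 0 < α) (hrqc : RobustlyQuasiconvex φ α) :
    ∀ x y : X, ∀ xs ∈ FrechetSubdiff φ x, ∀ ys ∈ FrechetSubdiff φ y,
      -(α * ‖y - x‖) < min (xs (y - x)) (ys (x - y)) →
      0 ≤ (xs - ys) (x - y) := by
  intro x y xs hxs ys hys hmin
  obtain ⟨h1, h2⟩ := lt_min_iff.1 hmin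
  by_cases hd : y - x = 0
  · have : x - y = 0 := by rw [← neg_sub, hd, neg_zero]
    simp [this]
  by_contra hneg
  push Not at hneg
  have hxy : x - y = -(y - x) := (neg_sub y x).symm
  rw [hxy] at hneg h2
  generalize hdd : y - x = d at *
  simp only [sub_apply, map_neg] at hneg h2
  have hr : 0 < ‖d‖ := norm_pos_iff.2 hd
  have har : 0 < α * ‖d‖ := by positivity
  obtain ⟨c, hc1, hc2⟩ : ∃ c, max (ys d) (-(α * ‖d‖)) < c ∧ c < min (xs d) (α * ‖d‖) :=
    exists_between (by rw [max_lt_iff, lt_min_iff, lt_min_iff]; constructor <;> constructor <;> linarith)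
  obtain ⟨hc1, hc3⟩ := max_lt_iff.1 hc1
  obtain ⟨hc2, hc4⟩ := lt_min_iff.1 hc2
  obtain ⟨g, hg1, hg2⟩ := exists_dual_vector ℝ d hr.ne'
  have hg2' : g d = ‖d‖ := by simpa using hg2
  have hvd : ((-c / ‖d‖) • g) d = -c := by
    simp [hg2', hr.ne']
  have hvn : ‖(-c / ‖d‖) • g‖ ≤ α := by
    rw [norm_smul, hg1, mul_one, norm_div, norm_norm, div_le_iff₀ hr, norm_neg, Real.norm_eq_abs,
      abs_le]
    constructor <;> linarith
  generalize (-c / ‖d‖) • g = v at *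
  have hq := hrqc v hvn
  obtain ⟨t, ht0, ht1, ht⟩ := exists_gt_of_frechet φ hnobot x d xs v hxs (by linarith)
  obtain ⟨s, hs0, hs1, hs⟩ := exists_gt_of_frechet φ hnobot y (-d) ys v hys
    (by simp only [map_neg]; linarith)
  have q1 := hq y x t ht0 ht1
  have q2 := hq x y s hs0 hs1
  have e1 : t • y + (1 - t) • x = x + t • d := by rw [← hdd]; module
  have e2 : s • x + (1 - s) • y = y + s • (-d) := by rw [← hdd]; module
  rw [e1] at q1
  rw [e2] at q2
  have r1 := (lt_max_iff.1 (ht.trans_le q1)).resolve_right (lt_irrefl _)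
  have r2 := (lt_max_iff.1 (hs.trans_le q2)).resolve_right (lt_irrefl _)
  exact lt_asymm r1 r2
end
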